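/- Assume max_{1≤i≤n} ‖W_i‖ ≤ √d+√m+√(2γ log n), ‖W‖ ≤ √(nd)+√m+√(2γ log n), max_{1≤i≤n} ‖W^(i)‖ ≤ √(nd)+√m+√(2γ log n), and σ ≤ √n·σ_min(A)/(16(√(nd)+√m+√(2γ n log n))). Then, with probability at least 1 − C·n^{−γ+1} for an absolute constant C: (i) ‖Σ^{−1}‖ ≤ 2/(√n·σ_min(A)) and ‖Σ‖ ≤ 2√n‖A‖; (ii) ‖V − V₀R‖ ≤ 4σ(√(nd)+√m+√(2γ log n))/(√n·σ_min(A)) where R = P(V₀^T V); (iii) max_{1≤i≤n} ‖W_i(V − V₀R)‖ ≤ (3/4)(√m+√d+√(2γ log n))·max_{1≤i≤n}‖U_i‖ + (5/2)(2√d+√(2γ log n)); and (iv) max_{1≤i≤n} ‖U − U^(i)Q_U^(i)‖ ≤ (12σ(√m+√d+√(2γ log n))/(√n·σ_min(A)))·max_{1≤i≤n}‖U_i‖ + 4σ(2√d+√(2γ log n))/(√n·σ_min(A)), where Q_U^(i) = P((U^(i))^T U). -/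

import Mathlib

open MeasureTheory Matrix Filter

namespace GOPP

/-- Frobenius norm of a real matrix. -/
noncomputable def frob {α β : Type*} [Fintype α] [Fintype β] (X : Matrix α β ℝ) : ℝ :=
  Real.sqrt (∑ i, ∑ j, X i j ^ 2)

/-- Euclidean norm of a vector. -/
noncomputable def vnorm {β : Type*} [Fintype β] (v : β → ℝ) : ℝ :=
  Real.sqrt (∑ j, v j ^ 2)

/-- Operator (spectral) norm: the supremum of ‖Xu‖ over unit vectors u. -/
noncomputable def opNorm {α β : Type*} [Fintype α] [Fintype β] (X : Matrix α β ℝ) : ℝ :=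
  sSup {r : ℝ | ∃ u : β → ℝ, vnorm u = 1 ∧ r = vnorm (X.mulVec u)}

/-- Smallest singular value: the infimum of ‖uᵀX‖ over unit vectors u (for a d×m matrix
with d ≤ m this is the d-th largest singular value; for square matrices it is σ_min). -/
noncomputable def sigmaMin {α β : Type*} [Fintype α] [Fintype β] (X : Matrix α β ℝ) : ℝ :=
  sInf {r : ℝ | ∃ u : α → ℝ, vnorm u = 1 ∧ r = vnorm (Matrix.vecMul u X)}

/-- Condition number κ = σ_max/σ_min. -/
noncomputable def kappa {d m : ℕ} (A : Matrix (Fin d) (Fin m) ℝ) : ℝ :=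
  opNorm A / sigmaMin A

/-- Q is an orthogonal matrix. -/
def IsOrth {d : ℕ} (Q : Matrix (Fin d) (Fin d) ℝ) : Prop :=
  Qᵀ * Q = 1 ∧ Q * Qᵀ = 1

/-- Nuclear norm, via the dual characterization ‖M‖_* = max_{Q ∈ O(d)} ⟨Q, M⟩. -/
noncomputable def nuclearNorm {d : ℕ} (M : Matrix (Fin d) (Fin d) ℝ) : ℝ :=
  sSup {r : ℝ | ∃ Q : Matrix (Fin d) (Fin d) ℝ, IsOrth Q ∧ r = Matrix.trace (Qᵀ * M)}

/-- The i-th d×k block of an (nd)×k block matrix. -/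
def blk {n d k : ℕ} (S : Matrix (Fin n × Fin d) (Fin k) ℝ) (i : Fin n) :
    Matrix (Fin d) (Fin k) ℝ :=
  Matrix.of fun a b => S (i, a) b

/-- The i-th diagonal d×d block of an (nd)×(nd) matrix. -/
def dblk {n d : ℕ} (G : Matrix (Fin n × Fin d) (Fin n × Fin d) ℝ) (i : Fin n) :
    Matrix (Fin d) (Fin d) ℝ :=
  Matrix.of fun a b => G (i, a) (i, b)

/-- S ∈ O(d)^{⊗n}: each of the n d×d blocks of S is orthogonal. -/
def OrthBlocks {n d : ℕ} (S : Matrix (Fin n × Fin d) (Fin d) ℝ) : Prop :=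
  ∀ i, IsOrth (blk S i)

/-- Z ∈ ℝ^{nd×d}: the vertical stack of n copies of I_d. -/
def ZStack (n d : ℕ) : Matrix (Fin n × Fin d) (Fin d) ℝ :=
  Matrix.of fun p j => if p.2 = j then 1 else 0

/-- Vertical stack of n given d×k matrices. -/
def stack {n d k : ℕ} (B : Fin n → Matrix (Fin d) (Fin k) ℝ) :
    Matrix (Fin n × Fin d) (Fin k) ℝ :=
  Matrix.of fun p b => B p.1 p.2 b

/-- d_F(X,Y) = min_{Q ∈ O(d)} ‖X − YQ‖_F. -/
noncomputable def dF {n d : ℕ} (X Y : Matrix (Fin n × Fin d) (Fin d) ℝ) : ℝ :=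
  sInf {r : ℝ | ∃ Q, IsOrth Q ∧ r = frob (X - Y * Q)}

/-- R is a polar factor P(X) of X: an orthogonal global minimizer of ‖X − Q‖_F over O(d). -/
def IsPolar {d : ℕ} (X R : Matrix (Fin d) (Fin d) ℝ) : Prop :=
  IsOrth R ∧ ∀ Q : Matrix (Fin d) (Fin d) ℝ, IsOrth Q → frob (X - R) ≤ frob (X - Q)

/-- S = P_n(X): blockwise polar factor. -/
def IsPolarBlocks {n d : ℕ} (X S : Matrix (Fin n × Fin d) (Fin d) ℝ) : Prop :=
  ∀ i, IsPolar (blk X i) (blk S i)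

/-- U collects (an orthonormal basis of the span of) the top d left singular vectors of D:
U has orthonormal columns and maximizes the Ky Fan quantity trace(Uᵀ(DDᵀ)U). -/
def IsTopSingVecs {N : Type*} [Fintype N] {d m : ℕ} (D : Matrix N (Fin m) ℝ)
    (U : Matrix N (Fin d) ℝ) : Prop :=
  Uᵀ * U = 1 ∧ ∀ Q : Matrix N (Fin d) ℝ, Qᵀ * Q = 1 →
    Matrix.trace (Qᵀ * (D * Dᵀ) * Q) ≤ Matrix.trace (Uᵀ * (D * Dᵀ) * U)

/-- (U, S, V) is a top-d singular triple of D: orthonormal U, V, diagonal nonnegative S,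
DV = US, DᵀU = VS, and U spans a top-d left singular subspace. -/
def IsSVDTriple {N : Type*} [Fintype N] {d m : ℕ} (D : Matrix N (Fin m) ℝ)
    (U : Matrix N (Fin d) ℝ) (S : Matrix (Fin d) (Fin d) ℝ)
    (V : Matrix (Fin m) (Fin d) ℝ) : Prop :=
  Vᵀ * V = 1 ∧ (∀ a b, a ≠ b → S a b = 0) ∧ (∀ a, 0 ≤ S a a) ∧
    D * V = U * S ∧ Dᵀ * U = V * S ∧ IsTopSingVecs D U

/-- The generalized power method sequence with spectral initialization, run on the data
matrix D (so with C = DDᵀ): S⁰ = P_n(U) for top singular vectors U of D, and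
S^{t+1} = P_n(C Sᵗ). -/
def IsGPM {n d m : ℕ} (D : Matrix (Fin n × Fin d) (Fin m) ℝ)
    (S : ℕ → Matrix (Fin n × Fin d) (Fin d) ℝ) : Prop :=
  (∃ U, IsTopSingVecs D U ∧ IsPolarBlocks U (S 0)) ∧
    ∀ t, IsPolarBlocks (D * Dᵀ * S t) (S (t + 1))

/-- W^(i): W with its i-th block row replaced by 0. -/
def mask {n d m : ℕ} (W : Matrix (Fin n × Fin d) (Fin m) ℝ) (i : Fin n) :
    Matrix (Fin n × Fin d) (Fin m) ℝ :=
  Matrix.of fun p b => if p.1 = i then 0 else W p b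

/-- The noise matrix Δ = WAᵀZᵀ + ZAWᵀ + σWWᵀ. -/
noncomputable def delta {n d m : ℕ} (A : Matrix (Fin d) (Fin m) ℝ)
    (W : Matrix (Fin n × Fin d) (Fin m) ℝ) (σ : ℝ) :
    Matrix (Fin n × Fin d) (Fin n × Fin d) ℝ :=
  W * Aᵀ * (ZStack n d)ᵀ + ZStack n d * A * Wᵀ + σ • (W * Wᵀ)

/-- The i-th block column Δ_i = WAᵀ + ZAW_iᵀ + σWW_iᵀ of Δ. -/
noncomputable def deltaCol {n d m : ℕ} (A : Matrix (Fin d) (Fin m) ℝ)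
    (W : Matrix (Fin n × Fin d) (Fin m) ℝ) (σ : ℝ) (i : Fin n) :
    Matrix (Fin n × Fin d) (Fin d) ℝ :=
  W * Aᵀ + ZStack n d * A * (blk W i)ᵀ + σ • (W * (blk W i)ᵀ)

/-- The operator L S = C S/(n‖A‖²) with C = ZAAᵀZᵀ + σΔ. -/
noncomputable def Lop {n d m : ℕ} (A : Matrix (Fin d) (Fin m) ℝ)
    (W : Matrix (Fin n × Fin d) (Fin m) ℝ) (σ : ℝ)
    (S : Matrix (Fin n × Fin d) (Fin d) ℝ) : Matrix (Fin n × Fin d) (Fin d) ℝ :=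
  ((n : ℝ) * opNorm A ^ 2)⁻¹ •
    ((ZStack n d * A * Aᵀ * (ZStack n d)ᵀ + σ • delta A W σ) * S)

/-- √(nd) + √m + √(2γ n log n). -/
noncomputable def bnd1 (n d m : ℕ) (γ : ℝ) : ℝ :=
  Real.sqrt ((n : ℝ) * d) + Real.sqrt (m : ℝ) + Real.sqrt (2 * γ * n * Real.log n)

/-- √(nd) + √m + √(2γ log n). -/
noncomputable def bnd2 (n d m : ℕ) (γ : ℝ) : ℝ :=
  Real.sqrt ((n : ℝ) * d) + Real.sqrt (m : ℝ) + Real.sqrt (2 * γ * Real.log n)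

/-- The basin of attraction N_ε. -/
def memNeps {n d : ℕ} (ε : ℝ) (S : Matrix (Fin n × Fin d) (Fin d) ℝ) : Prop :=
  OrthBlocks S ∧ dF S (ZStack n d) ≤ ε * Real.sqrt ((n : ℝ) * d)

/-- The basin of attraction N_{ξ,∞}. -/
def memNxi {n d m : ℕ} (W : Matrix (Fin n × Fin d) (Fin m) ℝ) (γ ξ : ℝ)
    (S : Matrix (Fin n × Fin d) (Fin d) ℝ) : Prop :=
  OrthBlocks S ∧ ∀ i, frob (blk W i * Wᵀ * S) ≤ ξ * Real.sqrt (d : ℝ) * bnd1 n d m γ ^ 2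

/-- The distribution of a matrix with i.i.d. standard Gaussian N(0,1) entries. -/
noncomputable def stdGaussian (ι κ : Type*) [Fintype ι] [Fintype κ] :
    Measure (ι → κ → ℝ) :=
  Measure.pi fun _ : ι => Measure.pi fun _ : κ => ProbabilityTheory.gaussianReal 0 1

section GaussianTail

open ProbabilityTheory

lemma map_dotProduct_pi_gaussianReal {κ : Type*} [Fintype κ] (b : κ → ℝ) :
    (Measure.pi fun _ : κ => gaussianReal 0 1).map (fun w => w ⬝ᵥ b) =
      gaussianReal 0 (b ⬝ᵥ b).toNNReal := by
  have hfun : (fun w : κ → ℝ => w ⬝ᵥ b) =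
      (innerSL ℝ (WithLp.toLp 2 b : EuclideanSpace ℝ κ)) ∘ (WithLp.toLp 2) := by
    ext w
    simp [EuclideanSpace.inner_eq_star_dotProduct]
  rw [hfun, ← Measure.map_map (by fun_prop) (by fun_prop), map_pi_eq_stdGaussian,
    IsGaussian.map_eq_gaussianReal, integral_strongDual_stdGaussian, variance_dual_stdGaussian,
    innerSL_apply_norm, EuclideanSpace.real_norm_sq_eq]
  simp [dotProduct, pow_two]

lemma lintegral_exp_sq_gaussianReal_le (v : NNReal) (hv : v ≤ 1) :
    ∫⁻ z, ENNReal.ofReal (Real.exp (3 / 8 * z ^ 2)) ∂(gaussianReal 0 v) ≤ 2 := by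
  by_cases h0 : v = 0
  · subst h0
    simp
  have hv0 : (0 : ℝ) < v := by positivity
  have hv1 : (v : ℝ) ≤ 1 := by exact_mod_cast hv
  rw [gaussianReal_of_var_ne_zero _ h0, lintegral_withDensity_eq_lintegral_mul _ (by fun_prop)
    (by fun_prop)]
  have hb : 0 < 1 / (2 * (v : ℝ)) - 3 / 8 := by
    rw [sub_pos, lt_div_iff₀ (by positivity)]
    linarith
  have hfun : ∀ z : ℝ, (gaussianPDF 0 v * fun z => ENNReal.ofReal (Real.exp (3 / 8 * z ^ 2))) z =
      ENNReal.ofReal ((Real.sqrt (2 * Real.pi * v))⁻¹ *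
        Real.exp (-(1 / (2 * (v : ℝ)) - 3 / 8) * z ^ 2)) := by
    intro z
    rw [Pi.mul_apply, gaussianPDF, gaussianPDFReal, ← ENNReal.ofReal_mul (by positivity),
      mul_assoc, ← Real.exp_add]
    congr 3
    field_simp
    ring
  simp_rw [hfun]
  rw [← ofReal_integral_eq_lintegral_ofReal ((integrable_exp_neg_mul_sq hb).const_mul _)
    (Filter.Eventually.of_forall fun z => by positivity), integral_const_mul, integral_gaussian,
    ← Real.sqrt_inv, ← Real.sqrt_mul (by positivity)]
  have h2 : Real.sqrt ((2 * Real.pi * v)⁻¹ * (Real.pi / (1 / (2 * (v : ℝ)) - 3 / 8))) ≤ 2 := by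
    rw [Real.sqrt_le_left (by norm_num)]
    have : (2 * Real.pi * v)⁻¹ * (Real.pi / (1 / (2 * (v : ℝ)) - 3 / 8)) =
        1 / (1 - 3 / 4 * v) := by
      have h4 : 1 - 3 / 4 * (v : ℝ) ≠ 0 := by linarith
      have : 1 / (2 * (v : ℝ)) - 3 / 8 = (1 - 3 / 4 * v) / (2 * v) := by
        field_simp
        ring
      rw [this]
      have := Real.pi_ne_zero
      field_simp
    rw [this, div_le_iff₀ (by linarith)]
    linarith
  simpa using ENNReal.ofReal_le_ofReal h2

lemma lintegral_exp_sq_dotProduct_le {κ : Type*} [Fintype κ] (b : κ → ℝ) (hb : b ⬝ᵥ b ≤ 1) :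
    ∫⁻ w, ENNReal.ofReal (Real.exp (3 / 8 * (w ⬝ᵥ b) ^ 2))
      ∂(Measure.pi fun _ : κ => gaussianReal 0 1) ≤ 2 := by
  have hm : Measurable fun w : κ → ℝ => w ⬝ᵥ b := by
    unfold dotProduct; fun_prop
  rw [← lintegral_map (f := fun z => ENNReal.ofReal (Real.exp (3 / 8 * z ^ 2))) (by fun_prop) hm,
    map_dotProduct_pi_gaussianReal]
  exact lintegral_exp_sq_gaussianReal_le _ (by simpa using hb)

instance {ι κ : Type*} [Fintype ι] [Fintype κ] : IsProbabilityMeasure (stdGaussian ι κ) := by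
  unfold stdGaussian; infer_instance

lemma lintegral_exp_sq_mulVec_le {ι κ : Type*} [Fintype ι] [Fintype κ] (b : κ → ℝ)
    (hb : b ⬝ᵥ b ≤ 1) :
    ∫⁻ w, ENNReal.ofReal (Real.exp (3 / 8 * ((Matrix.of w *ᵥ b) ⬝ᵥ (Matrix.of w *ᵥ b))))
      ∂(stdGaussian ι κ) ≤ 2 ^ Fintype.card ι := by
  have hm : Measurable fun w : κ → ℝ => w ⬝ᵥ b := by
    unfold dotProduct; fun_prop
  have hm2 : Measurable fun w : κ → ℝ => ENNReal.ofReal (Real.exp (3 / 8 * (w ⬝ᵥ b) ^ 2)) := by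
    fun_prop
  have hfun : ∀ w : ι → κ → ℝ,
      ENNReal.ofReal (Real.exp (3 / 8 * ((Matrix.of w *ᵥ b) ⬝ᵥ (Matrix.of w *ᵥ b)))) =
        ∏ a, ENNReal.ofReal (Real.exp (3 / 8 * (w a ⬝ᵥ b) ^ 2)) := by
    intro w
    rw [← ENNReal.ofReal_prod_of_nonneg (fun _ _ => by positivity), ← Real.exp_sum,
      ← Finset.mul_sum]
    simp [dotProduct, mulVec, pow_two]
  simp_rw [hfun]
  rw [stdGaussian, lintegral_prod_eq_prod_lintegral_of_indepFun Finset.univ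
    (fun a (w : ι → κ → ℝ) => ENNReal.ofReal (Real.exp (3 / 8 * (w a ⬝ᵥ b) ^ 2)))
    (iIndepFun_pi (X := fun _ w => ENNReal.ofReal (Real.exp (3 / 8 * (w ⬝ᵥ b) ^ 2)))
      fun _ => hm2.aemeasurable) (fun a => hm2.comp (measurable_pi_apply a))]
  refine (Finset.prod_le_prod' (g := fun _ => 2) fun a _ => ?_).trans (by simp)
  have := (measurePreserving_eval (fun _ : ι => Measure.pi fun _ : κ => gaussianReal 0 1) a)
  rw [this.lintegral_comp hm2]
  exact lintegral_exp_sq_dotProduct_le b hb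

lemma measure_sq_mulVec_ge_le {ι κ : Type*} [Fintype ι] [Fintype κ] (b : κ → ℝ)
    {ρ : ℝ} (hρ : 0 < ρ) (hb : b ⬝ᵥ b ≤ ρ ^ 2) (s : ℝ) :
    stdGaussian ι κ {w | s * ρ ^ 2 ≤ (Matrix.of w *ᵥ b) ⬝ᵥ (Matrix.of w *ᵥ b)} ≤
      ENNReal.ofReal (2 ^ Fintype.card ι * Real.exp (-(3 / 8 * s))) := by
  have hb' : (ρ⁻¹ • b) ⬝ᵥ (ρ⁻¹ • b) ≤ 1 := by
    simp only [smul_dotProduct, dotProduct_smul, smul_eq_mul]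
    calc ρ⁻¹ * (ρ⁻¹ * b ⬝ᵥ b) ≤ ρ⁻¹ * (ρ⁻¹ * ρ ^ 2) := by gcongr
      _ = 1 := by field_simp
  have hmk := mul_meas_ge_le_lintegral₀ (μ := stdGaussian ι κ)
    (f := fun w => ENNReal.ofReal (Real.exp (3 / 8 *
      ((Matrix.of w *ᵥ (ρ⁻¹ • b)) ⬝ᵥ (Matrix.of w *ᵥ (ρ⁻¹ • b))))))
    (by
      apply Measurable.aemeasurable
      simp only [dotProduct, mulVec, Matrix.of_apply]
      fun_prop) (ENNReal.ofReal (Real.exp (3 / 8 * s)))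
  have hsub : {w : ι → κ → ℝ | s * ρ ^ 2 ≤ (Matrix.of w *ᵥ b) ⬝ᵥ (Matrix.of w *ᵥ b)} ⊆
      {w | ENNReal.ofReal (Real.exp (3 / 8 * s)) ≤ ENNReal.ofReal (Real.exp (3 / 8 *
      ((Matrix.of w *ᵥ (ρ⁻¹ • b)) ⬝ᵥ (Matrix.of w *ᵥ (ρ⁻¹ • b)))))} := by
    intro w hw
    simp only [Set.mem_ofPred_eq] at hw ⊢
    apply ENNReal.ofReal_le_ofReal
    gcongr
    simp only [mulVec_smul, smul_dotProduct, dotProduct_smul, smul_eq_mul]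
    calc s = ρ⁻¹ * (ρ⁻¹ * (s * ρ ^ 2)) := by field_simp
      _ ≤ _ := by gcongr
  have h := (mul_le_mul_right (measure_mono hsub) _).trans
    (hmk.trans (lintegral_exp_sq_mulVec_le _ hb'))
  rw [Real.exp_neg, ← div_eq_mul_inv, ENNReal.ofReal_div_of_pos (Real.exp_pos _),
    ENNReal.le_div_iff_mul_le (by simp [Real.exp_pos]) (by simp), mul_comm]
  refine h.trans_eq ?_
  rw [ENNReal.ofReal_pow (by norm_num)]
  simp

end GaussianTail

section OperatorNorm

set_option linter.unusedSectionVars false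

open scoped Matrix.Norms.L2Operator

variable {α β κ : Type*} [Fintype α] [Fintype β] [Fintype κ] [DecidableEq α] [DecidableEq β]
  [DecidableEq κ]

lemma vnorm_sq (v : β → ℝ) : vnorm v ^ 2 = v ⬝ᵥ v := by
  rw [vnorm, Real.sq_sqrt (Finset.sum_nonneg fun _ _ => sq_nonneg _)]
  simp [dotProduct, pow_two]

lemma vnorm_nonneg (v : β → ℝ) : 0 ≤ vnorm v := Real.sqrt_nonneg _

lemma vnorm_eq_norm (v : β → ℝ) : vnorm v = ‖(WithLp.toLp 2 v : EuclideanSpace ℝ β)‖ := by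
  rw [vnorm, EuclideanSpace.norm_eq]
  simp

lemma dotProduct_self_nonneg' (v : β → ℝ) : 0 ≤ v ⬝ᵥ v := by
  rw [← vnorm_sq]; positivity

lemma dotProduct_self_pos {v : β → ℝ} (hv : v ≠ 0) : 0 < v ⬝ᵥ v :=
  lt_of_le_of_ne (dotProduct_self_nonneg' v) fun h => hv (dotProduct_self_eq_zero.1 h.symm)

lemma vnorm_mulVec_le (X : Matrix α β ℝ) (v : β → ℝ) : vnorm (X *ᵥ v) ≤ ‖X‖ * vnorm v := by
  rw [vnorm_eq_norm, vnorm_eq_norm]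
  exact l2_opNorm_mulVec X (WithLp.toLp 2 v)

lemma mulVec_dotProduct_self_le (X : Matrix α β ℝ) (v : β → ℝ) :
    (X *ᵥ v) ⬝ᵥ (X *ᵥ v) ≤ ‖X‖ ^ 2 * (v ⬝ᵥ v) := by
  rw [← vnorm_sq, ← vnorm_sq, ← mul_pow]
  exact pow_le_pow_left₀ (vnorm_nonneg _) (vnorm_mulVec_le X v) 2

lemma norm_le_of_vnorm_mulVec_le {X : Matrix α β ℝ} {c : ℝ} (hc : 0 ≤ c)
    (h : ∀ v, vnorm (X *ᵥ v) ≤ c * vnorm v) : ‖X‖ ≤ c := by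
  rw [l2_opNorm_def]
  refine ContinuousLinearMap.opNorm_le_bound _ hc fun v => ?_
  have := h v
  rw [vnorm_eq_norm, vnorm_eq_norm] at this
  exact this

lemma norm_le_of_dotProduct_le {X : Matrix α β ℝ} {c : ℝ} (hc : 0 ≤ c)
    (h : ∀ v, (X *ᵥ v) ⬝ᵥ (X *ᵥ v) ≤ c ^ 2 * (v ⬝ᵥ v)) : ‖X‖ ≤ c := by
  refine norm_le_of_vnorm_mulVec_le hc fun v => ?_
  refine le_of_sq_le_sq ?_ (by have := vnorm_nonneg v; positivity)
  rw [mul_pow, vnorm_sq, vnorm_sq]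
  exact h v

lemma vnorm_smul (t : ℝ) (v : β → ℝ) : vnorm (t • v) = |t| * vnorm v := by
  rw [vnorm_eq_norm, vnorm_eq_norm, WithLp.toLp_smul, norm_smul, Real.norm_eq_abs]

lemma vnorm_pos {v : β → ℝ} (hv : v ≠ 0) : 0 < vnorm v := by
  have := dotProduct_self_pos hv
  rw [← vnorm_sq] at this
  exact lt_of_le_of_ne (vnorm_nonneg v) fun h => by rw [← h] at this; norm_num at this

lemma exists_unit_smul {v : β → ℝ} (hv : v ≠ 0) : ∃ u : β → ℝ, vnorm u = 1 ∧ v = vnorm v • u := by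
  have := vnorm_pos hv
  refine ⟨(vnorm v)⁻¹ • v, ?_, ?_⟩
  · rw [vnorm_smul, abs_of_pos (by positivity)]
    field_simp
  · rw [smul_smul, mul_inv_cancel₀ this.ne', one_smul]

lemma opNorm_eq_norm (X : Matrix α β ℝ) : opNorm X = ‖X‖ := by
  apply le_antisymm
  · refine Real.sSup_le ?_ (norm_nonneg _)
    rintro r ⟨u, hu, rfl⟩
    simpa [hu] using vnorm_mulVec_le X u
  · have hbdd : BddAbove {r : ℝ | ∃ u : β → ℝ, vnorm u = 1 ∧ r = vnorm (X.mulVec u)} := by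
      refine ⟨‖X‖, ?_⟩
      rintro r ⟨u, hu, rfl⟩
      simpa [hu] using vnorm_mulVec_le X u
    have h0 : 0 ≤ opNorm X := by
      refine Real.sSup_nonneg ?_
      rintro r ⟨u, hu, rfl⟩
      exact vnorm_nonneg _
    refine norm_le_of_vnorm_mulVec_le h0 fun v => ?_
    by_cases hv : v = 0
    · subst hv
      simp [vnorm]
    obtain ⟨u, hu, hvu⟩ := exists_unit_smul hv
    have h1 : vnorm (X *ᵥ u) ≤ opNorm X := le_csSup hbdd ⟨u, hu, rfl⟩
    have h2 : vnorm (X *ᵥ v) = vnorm v * vnorm (X *ᵥ u) := by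
      conv_lhs => rw [hvu]
      rw [mulVec_smul, vnorm_smul, abs_of_nonneg (vnorm_nonneg v)]
    rw [h2, mul_comm]
    exact mul_le_mul_of_nonneg_right h1 (vnorm_nonneg v)

lemma sigmaMin_mul_vnorm_le (X : Matrix α β ℝ) (v : α → ℝ) :
    sigmaMin X * vnorm v ≤ vnorm (Xᵀ *ᵥ v) := by
  by_cases hv : v = 0
  · subst hv
    simp [vnorm]
  obtain ⟨u, hu, hvu⟩ := exists_unit_smul hv
  have h1 : sigmaMin X ≤ vnorm (u ᵥ* X) := by
    refine csInf_le ⟨0, ?_⟩ ⟨u, hu, rfl⟩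
    rintro r ⟨u, hu, rfl⟩
    exact vnorm_nonneg _
  have h2 : vnorm (Xᵀ *ᵥ v) = vnorm v * vnorm (u ᵥ* X) := by
    conv_lhs => rw [hvu]
    rw [mulVec_smul, vnorm_smul, abs_of_nonneg (vnorm_nonneg v), mulVec_transpose]
  rw [h2, mul_comm]
  exact mul_le_mul_of_nonneg_left h1 (vnorm_nonneg v)

lemma norm_transpose (X : Matrix α β ℝ) : ‖Xᵀ‖ = ‖X‖ := by
  rw [← conjTranspose_eq_transpose_of_trivial, l2_opNorm_conjTranspose]

lemma norm_transpose_mul_self (X : Matrix α β ℝ) : ‖Xᵀ * X‖ = ‖X‖ ^ 2 := by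
  rw [← conjTranspose_eq_transpose_of_trivial, l2_opNorm_conjTranspose_mul_self, pow_two]

lemma norm_mul_le_mul {X : Matrix α β ℝ} {Y : Matrix β κ ℝ} {a b : ℝ} (hX : ‖X‖ ≤ a)
    (hY : ‖Y‖ ≤ b) : ‖X * Y‖ ≤ a * b :=
  (l2_opNorm_mul X Y).trans (mul_le_mul hX hY (norm_nonneg _) ((norm_nonneg _).trans hX))

lemma mulVec_dotProduct_mulVec (X : Matrix α β ℝ) (v w : β → ℝ) :
    (X *ᵥ v) ⬝ᵥ (X *ᵥ w) = v ⬝ᵥ ((Xᵀ * X) *ᵥ w) := by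
  rw [← mulVec_mulVec, dotProduct_mulVec v, vecMul_transpose]

lemma mulVec_dotProduct_self_of_orthonormal {U : Matrix α β ℝ} (hU : Uᵀ * U = 1) (v : β → ℝ) :
    (U *ᵥ v) ⬝ᵥ (U *ᵥ v) = v ⬝ᵥ v := by
  rw [mulVec_dotProduct_mulVec, hU, one_mulVec]

lemma norm_le_one_of_orthonormal {U : Matrix α β ℝ} (hU : Uᵀ * U = 1) : ‖U‖ ≤ 1 :=
  norm_le_of_dotProduct_le zero_le_one fun v => by
    rw [mulVec_dotProduct_self_of_orthonormal hU, one_pow, one_mul]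

/-- The orthogonal projection onto the complement of the column space of an orthonormal `U`. -/
def coproj (U : Matrix α β ℝ) : Matrix α α ℝ := 1 - U * Uᵀ

lemma coproj_transpose (U : Matrix α β ℝ) : (coproj U)ᵀ = coproj U := by
  simp [coproj]

lemma coproj_mul_self {U : Matrix α β ℝ} (hU : Uᵀ * U = 1) : coproj U * U = 0 := by
  rw [coproj, Matrix.sub_mul, Matrix.mul_assoc, hU]
  simp

lemma transpose_mul_coproj {U : Matrix α β ℝ} (hU : Uᵀ * U = 1) : Uᵀ * coproj U = 0 := by
  rw [coproj, Matrix.mul_sub, ← Matrix.mul_assoc, hU]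
  simp

lemma coproj_mul_coproj {U : Matrix α β ℝ} (hU : Uᵀ * U = 1) : coproj U * coproj U = coproj U := by
  conv_lhs => rhs; rw [coproj]
  rw [Matrix.mul_sub, ← Matrix.mul_assoc, coproj_mul_self hU]
  simp

lemma norm_coproj_le {U : Matrix α β ℝ} (hU : Uᵀ * U = 1) : ‖coproj U‖ ≤ 1 := by
  have h := norm_transpose_mul_self (coproj U)
  rw [coproj_transpose, coproj_mul_coproj hU] at h
  have := norm_nonneg (coproj U)
  nlinarith

lemma norm_coproj_mul_sq {U V : Matrix α β ℝ} (hU : Uᵀ * U = 1) (hV : Vᵀ * V = 1) :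
    ‖1 - (Uᵀ * V)ᵀ * (Uᵀ * V)‖ = ‖coproj U * V‖ ^ 2 := by
  rw [← norm_transpose_mul_self]
  congr 1
  calc 1 - (Uᵀ * V)ᵀ * (Uᵀ * V) = Vᵀ * (coproj U * V) := by
        rw [coproj, Matrix.sub_mul, Matrix.mul_sub, Matrix.one_mul, hV]
        simp [Matrix.mul_assoc]
    _ = (coproj U * V)ᵀ * (coproj U * V) := by
        rw [transpose_mul, coproj_transpose, Matrix.mul_assoc, ← Matrix.mul_assoc (coproj U),
          coproj_mul_coproj hU]

lemma norm_inv_diagonal_le {s : β → ℝ} {r : ℝ} (hr : 0 < r) (hs : ∀ a, r ≤ s a) :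
    ‖(diagonal s)⁻¹‖ ≤ r⁻¹ := by
  have : (diagonal s)⁻¹ = diagonal fun a => (s a)⁻¹ := by
    apply inv_eq_right_inv
    rw [diagonal_mul_diagonal, ← diagonal_one]
    congr 1
    ext a
    exact mul_inv_cancel₀ (hr.trans_le (hs a)).ne'
  rw [this, l2_opNorm_diagonal]
  refine (pi_norm_le_iff_of_nonneg (by positivity)).2 fun a => ?_
  have := hr.trans_le (hs a)
  rw [Real.norm_eq_abs, abs_of_pos (by positivity)]
  exact inv_anti₀ hr (hs a)

/-- If `X * diag s` is bounded and `s ≥ r`, then so is `X`. -/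
lemma norm_mul_le_norm_mul_diagonal {X : Matrix α β ℝ} {s : β → ℝ} {r : ℝ} (hr : 0 < r)
    (hs : ∀ a, r ≤ s a) : r * ‖X‖ ≤ ‖X * diagonal s‖ := by
  have hdet : IsUnit (diagonal s).det := by
    rw [det_diagonal, isUnit_iff_ne_zero]
    exact Finset.prod_ne_zero_iff.2 fun a _ => (hr.trans_le (hs a)).ne'
  have h : X = X * diagonal s * (diagonal s)⁻¹ := by
    rw [Matrix.mul_assoc, mul_nonsing_inv _ hdet, Matrix.mul_one]
  have h2 : ‖X‖ ≤ ‖X * diagonal s‖ * r⁻¹ := by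
    conv_lhs => rw [h]
    exact norm_mul_le_mul le_rfl (norm_inv_diagonal_le hr hs)
  rw [← div_eq_mul_inv, le_div_iff₀ hr] at h2
  linarith

end OperatorNorm

section Polar

open scoped Matrix.Norms.L2Operator

variable {d : ℕ}

lemma frob_sq {α β : Type*} [Fintype α] [Fintype β] (X : Matrix α β ℝ) :
    frob X ^ 2 = trace (Xᵀ * X) := by
  have h : 0 ≤ ∑ i, ∑ j, X i j ^ 2 :=
    Finset.sum_nonneg fun _ _ => Finset.sum_nonneg fun _ _ => sq_nonneg _
  rw [show frob X = √(∑ i, ∑ j, X i j ^ 2) from rfl, Real.sq_sqrt h, Finset.sum_comm]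
  simp [trace, mul_apply, pow_two]

lemma IsOrth.mul {P Q : Matrix (Fin d) (Fin d) ℝ} (hP : IsOrth P) (hQ : IsOrth Q) :
    IsOrth (P * Q) := by
  constructor
  · rw [transpose_mul, Matrix.mul_assoc, ← Matrix.mul_assoc Pᵀ, hP.1, Matrix.one_mul, hQ.1]
  · rw [transpose_mul, Matrix.mul_assoc, ← Matrix.mul_assoc Q, hQ.2, Matrix.one_mul, hP.2]

lemma IsOrth.transpose {P : Matrix (Fin d) (Fin d) ℝ} (hP : IsOrth P) : IsOrth Pᵀ :=
  ⟨by simpa using hP.2, by simpa using hP.1⟩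

lemma IsPolar.trace_mul_le {X R : Matrix (Fin d) (Fin d) ℝ} (h : IsPolar X R)
    {G : Matrix (Fin d) (Fin d) ℝ} (hG : IsOrth G) :
    trace (G * (Rᵀ * X)) ≤ trace (Rᵀ * X) := by
  have hle := h.2 (R * Gᵀ) (h.1.mul hG.transpose)
  have hexp : ∀ Q : Matrix (Fin d) (Fin d) ℝ, IsOrth Q →
      frob (X - Q) ^ 2 = trace (Xᵀ * X) + trace (1 : Matrix (Fin d) (Fin d) ℝ)
        - 2 * trace (Qᵀ * X) := by
    intro Q hQ
    rw [frob_sq, transpose_sub, Matrix.sub_mul, Matrix.mul_sub, Matrix.mul_sub, hQ.1]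
    simp only [trace_sub]
    rw [← trace_transpose (Xᵀ * Q), transpose_mul, transpose_transpose]
    ring
  have hsq := pow_le_pow_left₀ (Real.sqrt_nonneg _) hle 2
  change frob (X - R) ^ 2 ≤ frob (X - R * Gᵀ) ^ 2 at hsq
  rw [hexp _ h.1, hexp _ (h.1.mul hG.transpose), transpose_mul, transpose_transpose,
    Matrix.mul_assoc] at hsq
  linarith

/-- The Householder reflection along `v`. -/
noncomputable def householder (v : Fin d → ℝ) : Matrix (Fin d) (Fin d) ℝ :=
  1 - (2 / (v ⬝ᵥ v)) • vecMulVec v v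

lemma isOrth_householder {v : Fin d → ℝ} (hv : v ⬝ᵥ v ≠ 0) : IsOrth (householder v) := by
  have ht : (householder v)ᵀ = householder v := by
    simp [householder, transpose_vecMulVec]
  have hm : householder v * householder v = 1 := by
    simp only [householder, Matrix.sub_mul, Matrix.mul_sub, Matrix.one_mul, Matrix.mul_one,
      smul_mul_assoc, mul_smul_comm, vecMulVec_mul_vecMulVec, vecMulVec_smul, smul_sub, smul_smul]
    rw [show 2 / v ⬝ᵥ v * (2 / v ⬝ᵥ v * v ⬝ᵥ v) = 2 / v ⬝ᵥ v + 2 / v ⬝ᵥ v by field_simp; ring,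
      add_smul]
    abel
  exact ⟨by rw [ht, hm], by rw [ht, hm]⟩

lemma householder_mul (v : Fin d → ℝ) (M : Matrix (Fin d) (Fin d) ℝ) :
    householder v * M = M - (2 / (v ⬝ᵥ v)) • vecMulVec v (v ᵥ* M) := by
  rw [householder, Matrix.sub_mul, Matrix.one_mul, smul_mul_assoc, vecMulVec_mul]

lemma IsPolar.dotProduct_nonneg {X R : Matrix (Fin d) (Fin d) ℝ} (h : IsPolar X R)
    (v : Fin d → ℝ) : 0 ≤ v ⬝ᵥ ((Rᵀ * X) *ᵥ v) := by
  by_cases hv : v = 0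
  · simp [hv]
  have hpos := dotProduct_self_pos hv
  have := h.trace_mul_le (isOrth_householder hpos.ne')
  rw [householder_mul, trace_sub, trace_smul, trace_vecMulVec, smul_eq_mul,
    dotProduct_comm v (_ ᵥ* _), ← dotProduct_mulVec] at this
  have h2 : 0 ≤ 2 / (v ⬝ᵥ v) * (v ⬝ᵥ ((Rᵀ * X) *ᵥ v)) := by linarith
  exact nonneg_of_mul_nonneg_right h2 (by positivity)

lemma IsPolar.isSymm {X R : Matrix (Fin d) (Fin d) ℝ} (h : IsPolar X R) :
    (Rᵀ * X)ᵀ = Rᵀ * X := by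
  set M := Rᵀ * X with hM
  have key : ∀ u v : Fin d → ℝ, u ⬝ᵥ u ≠ 0 → v ⬝ᵥ v ≠ 0 →
      2 * (u ⬝ᵥ v) * (v ⬝ᵥ (M *ᵥ u)) / ((u ⬝ᵥ u) * (v ⬝ᵥ v)) ≤
        (u ⬝ᵥ (M *ᵥ u)) / (u ⬝ᵥ u) + (v ⬝ᵥ (M *ᵥ v)) / (v ⬝ᵥ v) := by
    intro u v hu hv
    have := h.trace_mul_le ((isOrth_householder hu).mul (isOrth_householder hv))
    rw [← hM, Matrix.mul_assoc, householder_mul, householder_mul] at this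
    simp only [trace_sub, trace_smul, trace_vecMulVec, smul_eq_mul, vecMul_sub, vecMul_smul,
      vecMul_vecMulVec, dotProduct_sub, dotProduct_smul] at this
    rw [dotProduct_comm v (_ ᵥ* _), ← dotProduct_mulVec, dotProduct_comm u (_ ᵥ* _),
      ← dotProduct_mulVec, dotProduct_comm u (v ᵥ* _), ← dotProduct_mulVec] at this
    have e : 2 * (u ⬝ᵥ v) * (v ⬝ᵥ (M *ᵥ u)) / ((u ⬝ᵥ u) * (v ⬝ᵥ v)) =
      2 / (u ⬝ᵥ u) * (2 / (v ⬝ᵥ v) * ((u ⬝ᵥ v) * (v ⬝ᵥ (M *ᵥ u)))) / 2 := by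
      field_simp
    rw [e, div_eq_inv_mul (u ⬝ᵥ (M *ᵥ u)), div_eq_inv_mul (v ⬝ᵥ (M *ᵥ v))]
    simp only [div_eq_mul_inv] at this ⊢
    linarith
  ext i j
  rw [transpose_apply]
  by_cases hij : i = j
  · rw [hij]
  have key2 : ∀ t : ℝ, t * (M j i - M i j) ≤ t ^ 2 * (M i i + M j j) := by
    intro t
    have huu : (Pi.single i 1 : Fin d → ℝ) ⬝ᵥ Pi.single i 1 = 1 := by simp
    have huv : (Pi.single i 1 : Fin d → ℝ) ⬝ᵥ (Pi.single i 1 + t • Pi.single j 1) = 1 := by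
      simp [Ne.symm hij]
    have hvv : (Pi.single i 1 + t • Pi.single j 1 : Fin d → ℝ) ⬝ᵥ
        (Pi.single i 1 + t • Pi.single j 1) = 1 + t ^ 2 := by
      simp [hij, Ne.symm hij, pow_two]
    have := key (Pi.single i 1) (Pi.single i 1 + t • Pi.single j 1) (by rw [huu]; norm_num)
      (by rw [hvv]; positivity)
    rw [huu, huv, hvv, div_one, one_mul, mul_one, ← sub_le_iff_le_add', div_sub' (by positivity),
      div_le_div_iff_of_pos_right (by positivity)] at this
    simp [mulVec_add, mulVec_smul, add_dotProduct, smul_dotProduct] at this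
    nlinarith
  have hc : 0 ≤ M i i + M j j := by
    have h1 := h.dotProduct_nonneg (Pi.single i 1)
    have h2 := h.dotProduct_nonneg (Pi.single j 1)
    simp [← hM] at h1 h2
    linarith
  set c := M i i + M j j
  have hδ := key2 ((M j i - M i j) / (c + 1))
  have h3 : (M j i - M i j) ^ 2 * (c + 1) ≤ (M j i - M i j) ^ 2 * c := by
    have : (M j i - M i j) / (c + 1) * (M j i - M i j) * (c + 1) ^ 2 ≤
      ((M j i - M i j) / (c + 1)) ^ 2 * c * (c + 1) ^ 2 := by gcongr
    field_simp at this
    linarith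
  have h4 : (M j i - M i j) ^ 2 = 0 := le_antisymm (by linarith) (sq_nonneg _)
  linarith [pow_eq_zero_iff (two_ne_zero) |>.1 h4]

lemma IsPolar.norm_sub_le {X R : Matrix (Fin d) (Fin d) ℝ} (h : IsPolar X R) :
    ‖X - R‖ ≤ ‖1 - Xᵀ * X‖ := by
  set H := Rᵀ * X with hH
  have hX : X = R * H := by rw [hH, ← Matrix.mul_assoc, h.1.2, Matrix.one_mul]
  have hXX : Xᵀ * X = H * H := by
    conv_lhs => rw [hX]
    rw [transpose_mul, Matrix.mul_assoc, ← Matrix.mul_assoc Rᵀ, h.1.1, Matrix.one_mul, h.isSymm]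
  have h1 : X - R = R * (H - 1) := by rw [Matrix.mul_sub, ← hX, Matrix.mul_one]
  have h2 : ‖H - 1‖ ≤ ‖1 - H * H‖ := by
    refine norm_le_of_dotProduct_le (norm_nonneg _) fun v => ?_
    refine le_trans ?_ (mulVec_dotProduct_self_le _ _)
    have : (1 - H * H) *ᵥ v = -((H - 1) *ᵥ v + H *ᵥ ((H - 1) *ᵥ v)) := by
      simp only [mulVec_mulVec, ← add_mulVec, ← neg_mulVec]
      congr 1
      rw [Matrix.mul_sub]
      simp
    rw [this]
    set w := (H - 1) *ᵥ v
    have hw := h.dotProduct_nonneg w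
    have hw2 := dotProduct_self_nonneg' (H *ᵥ w)
    simp only [neg_dotProduct, dotProduct_neg, add_dotProduct, dotProduct_add]
    rw [← hH] at hw
    rw [dotProduct_comm (H *ᵥ w) w]
    linarith
  rw [hXX, h1]
  calc ‖R * (H - 1)‖ ≤ 1 * ‖1 - H * H‖ :=
        norm_mul_le_mul (norm_le_one_of_orthonormal h.1.1) h2
    _ = _ := one_mul _

lemma IsPolar.norm_sub_mul_le {α : Type*} [Fintype α] [DecidableEq α] {U U' : Matrix α (Fin d) ℝ}
    (hU : Uᵀ * U = 1) (hU' : U'ᵀ * U' = 1) {Q : Matrix (Fin d) (Fin d) ℝ}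
    (h : IsPolar (U'ᵀ * U) Q) :
    ‖U'ᵀ * U - Q‖ ≤ ‖coproj U' * U‖ ^ 2 ∧
      ‖U - U' * Q‖ ≤ ‖coproj U' * U‖ + ‖coproj U' * U‖ ^ 2 := by
  have h1 : ‖U'ᵀ * U - Q‖ ≤ ‖coproj U' * U‖ ^ 2 := by
    rw [← norm_coproj_mul_sq hU' hU]
    exact h.norm_sub_le
  refine ⟨h1, ?_⟩
  have : U - U' * Q = coproj U' * U + U' * (U'ᵀ * U - Q) := by
    rw [coproj, Matrix.sub_mul, Matrix.mul_sub, Matrix.one_mul, ← Matrix.mul_assoc]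
    abel
  rw [this]
  refine (norm_add_le _ _).trans (add_le_add le_rfl ?_)
  calc ‖U' * (U'ᵀ * U - Q)‖ ≤ 1 * ‖coproj U' * U‖ ^ 2 :=
        norm_mul_le_mul (norm_le_one_of_orthonormal hU') h1
    _ = _ := one_mul _

end Polar

section SingularTriples

set_option linter.unusedSectionVars false

open scoped Matrix.Norms.L2Operator

variable {α β κ : Type*} [Fintype α] [Fintype β] [Fintype κ] [DecidableEq α] [DecidableEq β]
  [DecidableEq κ]

/-- `(U, diag s, V)` is a singular triple of `D` with all singular values at least `r`. -/
structure IsSingularTriple (r : ℝ) (D : Matrix α β ℝ) (U : Matrix α κ ℝ) (V : Matrix β κ ℝ)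
    (s : κ → ℝ) : Prop where
  left_orthonormal : Uᵀ * U = 1
  right_orthonormal : Vᵀ * V = 1
  mul_right : D * V = U * diagonal s
  mul_left : Dᵀ * U = V * diagonal s
  le : ∀ a, r ≤ s a

namespace IsSingularTriple

variable {r e : ℝ} {D : Matrix α β ℝ} {U : Matrix α κ ℝ} {V : Matrix β κ ℝ} {s : κ → ℝ}

lemma transpose_mul (h : IsSingularTriple r D U V s) : Uᵀ * D = diagonal s * Vᵀ := by
  have := congrArg Matrix.transpose h.mul_left
  simpa using this

lemma coproj_mul (h : IsSingularTriple r D U V s) : coproj U * D = D * coproj V := by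
  rw [coproj, coproj, Matrix.sub_mul, Matrix.mul_sub, Matrix.mul_assoc, h.transpose_mul,
    ← Matrix.mul_assoc D, h.mul_right]
  simp [Matrix.mul_assoc]

lemma mulVec_dotProduct_self_le (h : IsSingularTriple r D U V s) (he : 0 ≤ e) (her : e < r)
    {M : Matrix α κ ℝ} {A : Matrix κ β ℝ} {E : Matrix α β ℝ} (hD : D = M * A + E) (hE : ‖E‖ ≤ e)
    {x : β → ℝ} (hx : Vᵀ *ᵥ x = 0) : (D *ᵥ x) ⬝ᵥ (D *ᵥ x) ≤ e ^ 2 * (x ⬝ᵥ x) := by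
  let L : ((κ → ℝ) × ℝ) →ₗ[ℝ] (κ → ℝ) :=
    (mulVecLin A).comp ((mulVecLin V).coprod (LinearMap.toSpanSingleton ℝ (β → ℝ) x))
  have hker : LinearMap.ker L ≠ ⊥ := by
    apply LinearMap.ker_ne_bot_of_finrank_lt
    simp
  obtain ⟨⟨c, t⟩, hct, hne⟩ := (Submodule.ne_bot_iff _).1 hker
  have hA : A *ᵥ (V *ᵥ c + t • x) = 0 := by simpa [L] using hct
  have hDy : D *ᵥ (V *ᵥ c + t • x) = E *ᵥ (V *ᵥ c + t • x) := by
    rw [hD, add_mulVec, ← mulVec_mulVec, hA, mulVec_zero, zero_add]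
  have h1 : (D *ᵥ (V *ᵥ c + t • x)) ⬝ᵥ (D *ᵥ (V *ᵥ c + t • x)) ≤
      e ^ 2 * ((V *ᵥ c + t • x) ⬝ᵥ (V *ᵥ c + t • x)) := by
    rw [hDy]
    refine (GOPP.mulVec_dotProduct_self_le _ _).trans ?_
    exact mul_le_mul_of_nonneg_right (pow_le_pow_left₀ (norm_nonneg _) hE 2)
      (dotProduct_self_nonneg' _)
  have h2 : (V *ᵥ c + t • x) ⬝ᵥ (V *ᵥ c + t • x) = c ⬝ᵥ c + t ^ 2 * (x ⬝ᵥ x) := by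
    have hcx : (V *ᵥ c) ⬝ᵥ x = 0 := by
      rw [← vecMul_transpose, ← dotProduct_mulVec, hx, dotProduct_zero]
    have hxc : x ⬝ᵥ (V *ᵥ c) = 0 := by rw [dotProduct_comm, hcx]
    simp only [add_dotProduct, dotProduct_add, smul_dotProduct, dotProduct_smul, hcx, hxc,
      mulVec_dotProduct_self_of_orthonormal h.right_orthonormal, smul_eq_mul]
    ring
  have h3 : (D *ᵥ (V *ᵥ c + t • x)) ⬝ᵥ (D *ᵥ (V *ᵥ c + t • x)) =
      (diagonal s *ᵥ c) ⬝ᵥ (diagonal s *ᵥ c) + t ^ 2 * ((D *ᵥ x) ⬝ᵥ (D *ᵥ x)) := by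
    have hDV : D *ᵥ (V *ᵥ c) = U *ᵥ (diagonal s *ᵥ c) := by
      rw [mulVec_mulVec, h.mul_right, mulVec_mulVec]
    have hcx : (U *ᵥ (diagonal s *ᵥ c)) ⬝ᵥ (D *ᵥ x) = 0 := by
      rw [← vecMul_transpose, ← dotProduct_mulVec, mulVec_mulVec, h.transpose_mul,
        ← mulVec_mulVec, hx, mulVec_zero, dotProduct_zero]
    have hxc : (D *ᵥ x) ⬝ᵥ (U *ᵥ (diagonal s *ᵥ c)) = 0 := by rw [dotProduct_comm, hcx]
    simp only [mulVec_add, mulVec_smul, hDV, add_dotProduct, dotProduct_add, smul_dotProduct,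
      dotProduct_smul, hcx, hxc, mulVec_dotProduct_self_of_orthonormal h.left_orthonormal,
      smul_eq_mul]
    ring
  have h4 : r ^ 2 * (c ⬝ᵥ c) ≤ (diagonal s *ᵥ c) ⬝ᵥ (diagonal s *ᵥ c) := by
    simp only [dotProduct, mulVec_diagonal, Finset.mul_sum]
    refine Finset.sum_le_sum fun a _ => ?_
    have := pow_le_pow_left₀ (he.trans her.le) (h.le a) 2
    nlinarith [mul_self_nonneg (c a)]
  have hc := dotProduct_self_nonneg' c
  have hre : 0 < r ^ 2 - e ^ 2 := by nlinarith
  have ht : t ≠ 0 := by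
    rintro rfl
    have hcz : c ≠ 0 := by
      rintro rfl
      exact hne rfl
    have := dotProduct_self_pos hcz
    nlinarith
  have ht2 : 0 < t ^ 2 := by positivity
  have : t ^ 2 * ((D *ᵥ x) ⬝ᵥ (D *ᵥ x)) ≤ t ^ 2 * (e ^ 2 * (x ⬝ᵥ x)) := by nlinarith
  exact le_of_mul_le_mul_left this ht2

lemma norm_mul_coproj_le (h : IsSingularTriple r D U V s) (he : 0 ≤ e) (her : e < r)
    {M : Matrix α κ ℝ} {A : Matrix κ β ℝ} {E : Matrix α β ℝ} (hD : D = M * A + E)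
    (hE : ‖E‖ ≤ e) : ‖D * coproj V‖ ≤ e := by
  refine norm_le_of_dotProduct_le he fun v => ?_
  rw [← mulVec_mulVec]
  refine (h.mulVec_dotProduct_self_le he her hD hE ?_).trans ?_
  · rw [mulVec_mulVec, transpose_mul_coproj h.right_orthonormal, zero_mulVec]
  · refine mul_le_mul_of_nonneg_left ?_ (sq_nonneg e)
    refine (GOPP.mulVec_dotProduct_self_le _ _).trans ?_
    have h1 := norm_coproj_le h.right_orthonormal
    exact mul_le_of_le_one_left (dotProduct_self_nonneg' _) (pow_le_one₀ (norm_nonneg _) h1)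

variable {D' : Matrix α β ℝ} {U' : Matrix α κ ℝ} {V' : Matrix β κ ℝ} {s' : κ → ℝ}

/-- A Wedin-type perturbation bound. -/
lemma norm_coproj_mul_le (hr : 0 < r) (h : IsSingularTriple r D U V s)
    (h' : IsSingularTriple r D' U' V' s') (he : ‖D' * coproj V'‖ ≤ e) :
    r * ‖coproj U' * U‖ ≤ e * ‖coproj V' * V‖ + ‖(D - D') * V‖ ∧
      r * ‖coproj V' * V‖ ≤ e * ‖coproj U' * U‖ + ‖(D - D')ᵀ * U‖ := by
  constructor
  · refine (norm_mul_le_norm_mul_diagonal hr h.le).trans ?_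
    have : coproj U' * U * diagonal s =
        (D' * coproj V') * (coproj V' * V) + coproj U' * ((D - D') * V) := by
      rw [Matrix.mul_assoc, ← h.mul_right, Matrix.mul_assoc, ← Matrix.mul_assoc (coproj V'),
        coproj_mul_coproj h'.right_orthonormal, ← Matrix.mul_assoc D', ← h'.coproj_mul,
        Matrix.sub_mul, Matrix.mul_sub, Matrix.mul_assoc]
      abel
    rw [this]
    refine (norm_add_le _ _).trans (add_le_add (norm_mul_le_mul he le_rfl) ?_)
    exact (norm_mul_le_mul (norm_coproj_le h'.left_orthonormal) le_rfl).trans_eq (one_mul _)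
  · refine (norm_mul_le_norm_mul_diagonal hr h.le).trans ?_
    have ht : (D' * coproj V')ᵀ = D'ᵀ * coproj U' := by
      rw [← h'.coproj_mul, Matrix.transpose_mul, coproj_transpose]
    have ht' : (D' * coproj V')ᵀ = coproj V' * D'ᵀ := by
      rw [Matrix.transpose_mul, coproj_transpose]
    have : coproj V' * V * diagonal s =
        (D' * coproj V')ᵀ * (coproj U' * U) + coproj V' * ((D - D')ᵀ * U) := by
      rw [Matrix.mul_assoc, ← h.mul_left, ht, Matrix.mul_assoc, ← Matrix.mul_assoc (coproj U'),
        coproj_mul_coproj h'.left_orthonormal, ← Matrix.mul_assoc D'ᵀ, ← ht, ht',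
        transpose_sub, Matrix.sub_mul, Matrix.mul_sub, Matrix.mul_assoc]
      abel
    rw [this]
    refine (norm_add_le _ _).trans (add_le_add (norm_mul_le_mul ?_ le_rfl) ?_)
    · rwa [norm_transpose]
    · exact (norm_mul_le_mul (norm_coproj_le h'.right_orthonormal) le_rfl).trans_eq (one_mul _)

/-- Uniqueness of the right singular projection in the presence of a gap. -/
lemma coproj_mul_eq_zero (hr : 0 < r) (h : IsSingularTriple r D U V s)
    (h' : IsSingularTriple r D U' V' s') (he : ‖D * coproj V'‖ ≤ e) (her : e < r) :
    coproj V' * V = 0 := by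
  obtain ⟨h1, h2⟩ := norm_coproj_mul_le hr h h' he
  rw [sub_self, Matrix.zero_mul, norm_zero] at h1
  rw [sub_self, transpose_zero, Matrix.zero_mul, norm_zero] at h2
  have h3 := norm_nonneg (coproj V' * V)
  have h4 := norm_nonneg (coproj U' * U)
  rw [← norm_eq_zero]
  nlinarith

end IsSingularTriple

/-- A Ky Fan maximizer has all its singular values above `r` as soon as `Dᵀ` is bounded below
by `r` on a `d`-dimensional subspace. -/
lemma IsSVDTriple.le_of_forall_le {d m : ℕ} {D : Matrix α (Fin m) ℝ} {U : Matrix α (Fin d) ℝ}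
    {S : Matrix (Fin d) (Fin d) ℝ} {V : Matrix (Fin m) (Fin d) ℝ} (h : IsSVDTriple D U S V)
    {M : Matrix α (Fin d) ℝ} (hM : ∀ c, c ≠ 0 → M *ᵥ c ≠ 0) {r : ℝ}
    (hle : ∀ c, r ^ 2 * ((M *ᵥ c) ⬝ᵥ (M *ᵥ c)) ≤ (Dᵀ *ᵥ (M *ᵥ c)) ⬝ᵥ (Dᵀ *ᵥ (M *ᵥ c)))
    (a : Fin d) : r ≤ S a a := by
  obtain ⟨hV, hS, hS0, hDV, hDU, hU, hmax⟩ := h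
  have hsum : ∀ Q : Matrix α (Fin d) ℝ, trace (Qᵀ * (D * Dᵀ) * Q) =
      ∑ b, (Dᵀ *ᵥ Q.col b) ⬝ᵥ (Dᵀ *ᵥ Q.col b) := by
    intro Q
    have : Qᵀ * (D * Dᵀ) * Q = (Dᵀ * Q)ᵀ * (Dᵀ * Q) := by
      rw [transpose_mul, transpose_transpose]
      simp only [Matrix.mul_assoc]
    rw [this]
    rfl
  let L : (Fin d → ℝ) →ₗ[ℝ] ({b : Fin d // b ≠ a} → ℝ) :=
    (LinearMap.funLeft ℝ ℝ Subtype.val).comp (mulVecLin (Uᵀ * M))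
  have hker : LinearMap.ker L ≠ ⊥ := by
    apply LinearMap.ker_ne_bot_of_finrank_lt
    have := a.pos
    simp [Fintype.card_subtype_compl]
    omega
  obtain ⟨c, hc, hc0⟩ := (Submodule.ne_bot_iff _).1 hker
  obtain ⟨u, hu, hyu⟩ := exists_unit_smul (hM c hc0)
  have hy := vnorm_pos (hM c hc0)
  have horth : ∀ b, b ≠ a → U.col b ⬝ᵥ u = 0 := by
    intro b hb
    have h1 : U.col b ⬝ᵥ (M *ᵥ c) = 0 := by
      have := congrFun hc ⟨b, hb⟩
      rw [LinearMap.comp_apply, mulVecLin_apply, ← mulVec_mulVec] at this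
      exact this
    rw [hyu, dotProduct_smul, smul_eq_mul] at h1
    exact (mul_eq_zero.1 h1).resolve_left hy.ne'
  have huu : u ⬝ᵥ u = 1 := by rw [← vnorm_sq, hu, one_pow]
  have hcol : ∀ b b', U.col b ⬝ᵥ U.col b' = if b = b' then 1 else 0 := by
    intro b b'
    have := congrFun (congrFun hU b) b'
    rw [Matrix.one_apply] at this
    exact this
  have hQ : (U.updateCol a u)ᵀ * U.updateCol a u = 1 := by
    ext b b'
    change (U.updateCol a u).col b ⬝ᵥ (U.updateCol a u).col b' = _
    have hcu : ∀ b, (U.updateCol a u).col b = if b = a then u else U.col b := by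
      intro b
      ext i
      simp only [Matrix.col_apply, updateCol_apply]
      split_ifs <;> rfl
    rw [hcu, hcu, Matrix.one_apply]
    by_cases hb : b = a <;> by_cases hb' : b' = a
    · simp [hb, hb', huu]
    · simp [hb, hb', Ne.symm hb', dotProduct_comm u, horth b' hb']
    · simp [hb, hb', horth b hb]
    · simp [hb, hb', hcol]
  have h1 := hmax _ hQ
  rw [hsum, hsum, ← Finset.add_sum_erase _ _ (Finset.mem_univ a),
    ← Finset.add_sum_erase (a := a) _ _ (Finset.mem_univ a)] at h1
  have h2 : ∑ b ∈ Finset.univ.erase a,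
      (Dᵀ *ᵥ (U.updateCol a u).col b) ⬝ᵥ (Dᵀ *ᵥ (U.updateCol a u).col b) =
      ∑ b ∈ Finset.univ.erase a, (Dᵀ *ᵥ U.col b) ⬝ᵥ (Dᵀ *ᵥ U.col b) := by
    refine Finset.sum_congr rfl fun b hb => ?_
    have : (U.updateCol a u).col b = U.col b := by
      ext i
      simp [Matrix.col_apply, Finset.ne_of_mem_erase hb]
    rw [this]
  have h3 : (U.updateCol a u).col a = u := by
    ext i
    simp [Matrix.col_apply]
  have h4 : (Dᵀ *ᵥ U.col a) ⬝ᵥ (Dᵀ *ᵥ U.col a) = S a a ^ 2 := by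
    have hv : Dᵀ *ᵥ U.col a = S a a • V.col a := by
      ext i
      have := congrFun (congrFun hDU i) a
      rw [mul_apply, mul_apply, Finset.sum_eq_single a (fun b _ hb => by rw [hS b a hb, mul_zero])
        (fun h => absurd (Finset.mem_univ a) h)] at this
      rw [Pi.smul_apply, smul_eq_mul, mul_comm]
      exact this
    have hvv : V.col a ⬝ᵥ V.col a = 1 := by
      have := congrFun (congrFun hV a) a
      rw [Matrix.one_apply_eq] at this
      exact this
    rw [hv, smul_dotProduct, dotProduct_smul, hvv, smul_eq_mul, smul_eq_mul]
    ring
  rw [h2, h3, h4] at h1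
  have h5 := hle c
  rw [hyu] at h5
  simp only [mulVec_smul, smul_dotProduct, dotProduct_smul, huu, smul_eq_mul] at h5
  have h6 : r ^ 2 ≤ S a a ^ 2 := by
    have hy2 : 0 < vnorm (M *ᵥ c) ^ 2 := by positivity
    have : vnorm (M *ᵥ c) ^ 2 * r ^ 2 ≤ vnorm (M *ᵥ c) ^ 2 * S a a ^ 2 := by nlinarith
    exact le_of_mul_le_mul_left this hy2
  exact le_of_sq_le_sq h6 (hS0 a)

lemma IsSVDTriple.eq_diagonal {d m : ℕ} {D : Matrix α (Fin m) ℝ} {U : Matrix α (Fin d) ℝ}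
    {S : Matrix (Fin d) (Fin d) ℝ} {V : Matrix (Fin m) (Fin d) ℝ} (h : IsSVDTriple D U S V) :
    S = diagonal fun a => S a a := by
  ext a b
  by_cases hab : a = b
  · subst hab
    simp
  · rw [diagonal_apply_ne _ hab, h.2.1 a b hab]

lemma IsSVDTriple.isSingularTriple {d m : ℕ} {D : Matrix α (Fin m) ℝ} {U : Matrix α (Fin d) ℝ}
    {S : Matrix (Fin d) (Fin d) ℝ} {V : Matrix (Fin m) (Fin d) ℝ} (h : IsSVDTriple D U S V)
    {r : ℝ} (hr : ∀ a, r ≤ S a a) : IsSingularTriple r D U V fun a => S a a where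
  left_orthonormal := h.2.2.2.2.2.1
  right_orthonormal := h.1
  mul_right := by rw [← h.eq_diagonal, h.2.2.2.1]
  mul_left := by rw [← h.eq_diagonal, h.2.2.2.2.1]
  le := hr

/-- Existence of a singular triple above `r` when `Dᵀ` is bounded below by `r` on a subspace of
full dimension. -/
lemma exists_isSingularTriple {D : Matrix α β ℝ} {M : Matrix α κ ℝ}
    (hM : ∀ c, c ≠ 0 → M *ᵥ c ≠ 0) {r : ℝ} (hr : 0 < r)
    (hle : ∀ c, r ^ 2 * ((M *ᵥ c) ⬝ᵥ (M *ᵥ c)) ≤ (Dᵀ *ᵥ (M *ᵥ c)) ⬝ᵥ (Dᵀ *ᵥ (M *ᵥ c))) :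
    ∃ U V, ∃ s : κ → ℝ, IsSingularTriple r D U V s := by
  have hH : (D * Dᵀ).IsHermitian := by
    rw [IsHermitian, conjTranspose_eq_transpose_of_trivial]
    simp
  set lam := hH.eigenvalues with hlam
  set P : Matrix α α ℝ := (hH.eigenvectorUnitary : Matrix α α ℝ) with hP
  have hPP : Pᵀ * P = 1 := by
    rw [← conjTranspose_eq_transpose_of_trivial, hP]
    exact Unitary.coe_star_mul_self hH.eigenvectorUnitary
  have hPP' : P * Pᵀ = 1 := mul_eq_one_comm.1 hPP
  have hspec : D * Dᵀ * P = P * diagonal lam := by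
    have h1 := hH.spectral_theorem
    have h2 : D * Dᵀ = P * diagonal lam * Pᵀ := by
      rw [← conjTranspose_eq_transpose_of_trivial P]
      exact h1
    rw [h2, Matrix.mul_assoc, hPP, Matrix.mul_one]
  have hcard : Fintype.card κ ≤ Fintype.card {k // r ^ 2 ≤ lam k} := by
    by_contra! hlt
    let L : (κ → ℝ) →ₗ[ℝ] ({k // r ^ 2 ≤ lam k} → ℝ) :=
      (LinearMap.funLeft ℝ ℝ Subtype.val).comp (mulVecLin (Pᵀ * M))
    have hker : LinearMap.ker L ≠ ⊥ := by
      apply LinearMap.ker_ne_bot_of_finrank_lt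
      simpa using hlt
    obtain ⟨c, hc, hc0⟩ := (Submodule.ne_bot_iff _).1 hker
    set x := Pᵀ *ᵥ (M *ᵥ c) with hx
    have hx0 : ∀ k, r ^ 2 ≤ lam k → x k = 0 := by
      intro k hk
      have := congrFun hc ⟨k, hk⟩
      rw [LinearMap.comp_apply, mulVecLin_apply, ← mulVec_mulVec] at this
      exact this
    have hMx : M *ᵥ c = P *ᵥ x := by rw [hx, mulVec_mulVec, hPP', one_mulVec]
    have hxne : x ≠ 0 := fun h => hM c hc0 (by rw [hMx, h, mulVec_zero])
    clear_value x
    have h1 := hle c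
    rw [hMx, mulVec_dotProduct_self_of_orthonormal hPP, mulVec_dotProduct_mulVec,
      transpose_transpose, mulVec_mulVec, hspec, ← mulVec_mulVec,
      mulVec_dotProduct_mulVec, hPP, one_mulVec] at h1
    obtain ⟨k, hk⟩ := Function.ne_iff.1 hxne
    have h2 : x ⬝ᵥ (diagonal lam *ᵥ x) < r ^ 2 * (x ⬝ᵥ x) := by
      simp only [dotProduct, mulVec_diagonal, Finset.mul_sum]
      refine Finset.sum_lt_sum (fun j _ => ?_) ⟨k, Finset.mem_univ _, ?_⟩
      · by_cases hj : r ^ 2 ≤ lam j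
        · simp [hx0 j hj]
        · push Not at hj
          nlinarith [mul_self_nonneg (x j)]
      · have hk' : lam k < r ^ 2 := by
          by_contra! h
          exact hk (hx0 k h)
        have : 0 < x k * x k := mul_self_pos.2 hk
        nlinarith
    linarith
  obtain ⟨f⟩ := Function.Embedding.nonempty_of_card_le hcard
  let U : Matrix α κ ℝ := P.submatrix id fun a => (f a : α)
  let s : κ → ℝ := fun a => √(lam (f a))
  have hs : ∀ a, r ≤ s a := fun a => Real.le_sqrt_of_sq_le (f a).2
  have hss : ∀ a, s a * s a = lam (f a) := fun a =>
    Real.mul_self_sqrt ((sq_nonneg r).trans (f a).2)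
  have hs0 : ∀ a, s a ≠ 0 := fun a => (hr.trans_le (hs a)).ne'
  have hUU : Uᵀ * U = 1 := by
    have : Uᵀ * U = (Pᵀ * P).submatrix (fun a => (f a : α)) fun a => (f a : α) := rfl
    rw [this, hPP]
    exact submatrix_one _ (Subtype.val_injective.comp f.injective)
  have hDDU : D * Dᵀ * U = U * diagonal fun a => s a * s a := by
    have : D * Dᵀ * U = (D * Dᵀ * P).submatrix id fun a => (f a : α) := rfl
    rw [this, hspec]
    ext i a
    simp [U, hss, mul_diagonal]
  have hinv : (diagonal fun a => (s a)⁻¹) * diagonal s = 1 := by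
    rw [diagonal_mul_diagonal, ← diagonal_one]
    congr 1
    ext a
    exact inv_mul_cancel₀ (hs0 a)
  refine ⟨U, Dᵀ * U * diagonal fun a => (s a)⁻¹, s, hUU, ?_, ?_, ?_, hs⟩
  · calc (Dᵀ * U * diagonal fun a => (s a)⁻¹)ᵀ * (Dᵀ * U * diagonal fun a => (s a)⁻¹)
        = (diagonal fun a => (s a)⁻¹) * (Uᵀ * (D * Dᵀ * U)) * diagonal fun a => (s a)⁻¹ := by
          simp [Matrix.mul_assoc]
      _ = 1 := by
          rw [hDDU, ← Matrix.mul_assoc Uᵀ, hUU, Matrix.one_mul, diagonal_mul_diagonal,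
            diagonal_mul_diagonal, ← diagonal_one]
          congr 1
          ext a
          have := hs0 a
          field_simp
  · rw [← Matrix.mul_assoc, ← Matrix.mul_assoc, hDDU, Matrix.mul_assoc, diagonal_mul_diagonal]
    congr 2
    ext a
    have := hs0 a
    field_simp
  · rw [Matrix.mul_assoc, hinv, Matrix.mul_one]

end SingularTriples

section Net

set_option linter.unusedSectionVars false

open scoped Matrix.Norms.L2Operator

variable {α β κ : Type*} [Fintype α] [Fintype β] [Fintype κ] [DecidableEq α] [DecidableEq β]
  [DecidableEq κ]

lemma exists_separated_net (κ : Type*) [Fintype κ] :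
    ∃ S : Finset (EuclideanSpace ℝ κ), S.card ≤ 5 ^ Fintype.card κ ∧ (∀ c ∈ S, ‖c‖ ≤ 2) ∧
      ∀ x, ‖x‖ ≤ 2 → ∃ c ∈ S, ‖x - c‖ < 1 := by
  classical
  let p : Finset (EuclideanSpace ℝ κ) → Prop := fun S =>
    (∀ c ∈ S, ‖c‖ ≤ 2) ∧ ∀ c ∈ S, ∀ c' ∈ S, c ≠ c' → 1 ≤ ‖c - c'‖
  have hcard : ∀ S, p S → S.card ≤ 5 ^ Fintype.card κ := fun S hS => by
    simpa using Besicovitch.card_le_of_separated S hS.1 hS.2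
  have hmem : sSup {k | ∃ S, p S ∧ S.card = k} ∈ {k | ∃ S, p S ∧ S.card = k} := by
    refine Nat.sSup_mem ⟨0, ∅, by simp [p], rfl⟩ ⟨5 ^ Fintype.card κ, ?_⟩
    rintro k ⟨S, hS, rfl⟩
    exact hcard S hS
  obtain ⟨S, hS, hmax⟩ := hmem
  refine ⟨S, hcard S hS, hS.1, fun x hx => ?_⟩
  by_contra! hfar
  have hxS : x ∉ S := fun h => by
    have := hfar x h
    norm_num at this
  have hp : p (insert x S) := by
    refine ⟨fun c hc => ?_, fun c hc c' hc' hne => ?_⟩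
    · rcases Finset.mem_insert.1 hc with rfl | hc
      · exact hx
      · exact hS.1 c hc
    · rcases Finset.mem_insert.1 hc with h | hc <;> rcases Finset.mem_insert.1 hc' with h' | hc'
      · exact absurd (h.trans h'.symm) hne
      · exact h ▸ hfar c' hc'
      · rw [norm_sub_rev, h']
        exact hfar c hc
      · exact hS.2 c hc c' hc' hne
  have h1 : (insert x S).card ≤ sSup {k | ∃ S, p S ∧ S.card = k} := by
    refine le_csSup ⟨5 ^ Fintype.card κ, ?_⟩ ⟨_, hp, rfl⟩
    rintro k ⟨S, hS, rfl⟩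
    exact hcard S hS
  rw [← hmax, Finset.card_insert_of_notMem hxS] at h1
  omega

/-- A finite set of test vectors controlling the operator norm. -/
lemma exists_net (κ : Type*) [Fintype κ] [DecidableEq κ] :
    ∃ S : Finset (κ → ℝ), S.card ≤ 5 ^ Fintype.card κ ∧ (∀ y ∈ S, vnorm y ≤ 2) ∧
      ∀ (G : Matrix α κ ℝ) (c : ℝ), (∀ y ∈ S, vnorm (G *ᵥ y) ≤ c) → ‖G‖ ≤ c := by
  classical
  obtain ⟨S, hcard, hS, hnet⟩ := exists_separated_net κ
  refine ⟨S.image WithLp.ofLp, Finset.card_image_le.trans hcard, fun y hy => ?_,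
    fun G c h => ?_⟩
  · obtain ⟨z, hz, rfl⟩ := Finset.mem_image.1 hy
    rw [vnorm_eq_norm]
    exact hS z hz
  · have hc : 0 ≤ c := by
      obtain ⟨z, hz, -⟩ := hnet 0 (by simp)
      exact (vnorm_nonneg _).trans (h _ (Finset.mem_image_of_mem _ hz))
    have hG := norm_nonneg G
    have key : ‖G‖ ≤ (c + ‖G‖) / 2 := by
      refine norm_le_of_vnorm_mulVec_le (by positivity) fun v => ?_
      by_cases hv : v = 0
      · subst hv
        simp [vnorm]
      obtain ⟨u, hu, hvu⟩ := exists_unit_smul hv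
      obtain ⟨z, hz, hzu⟩ := hnet (WithLp.toLp 2 ((2 : ℝ) • u)) (by
        rw [← vnorm_eq_norm, vnorm_smul, hu]
        norm_num)
      have h1 := h _ (Finset.mem_image_of_mem _ hz)
      have h2 : vnorm ((2 : ℝ) • u - z.ofLp) < 1 := by
        rw [vnorm_eq_norm]
        exact hzu
      have h3 : 2 * vnorm (G *ᵥ u) ≤ c + ‖G‖ := by
        have e1 : (2 : ℝ) * vnorm (G *ᵥ u) =
            vnorm (G *ᵥ z.ofLp + G *ᵥ ((2 : ℝ) • u - z.ofLp)) := by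
          rw [← mulVec_add, add_sub_cancel, mulVec_smul, vnorm_smul]
          norm_num
        have e2 : vnorm (G *ᵥ z.ofLp + G *ᵥ ((2 : ℝ) • u - z.ofLp)) ≤
            vnorm (G *ᵥ z.ofLp) + vnorm (G *ᵥ ((2 : ℝ) • u - z.ofLp)) := by
          simp only [vnorm_eq_norm, WithLp.toLp_add]
          exact norm_add_le _ _
        have e3 := vnorm_mulVec_le G ((2 : ℝ) • u - z.ofLp)
        nlinarith
      have h4 : vnorm (G *ᵥ v) = vnorm v * vnorm (G *ᵥ u) := by
        conv_lhs => rw [hvu]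
        rw [mulVec_smul, vnorm_smul, abs_of_nonneg (vnorm_nonneg v)]
      rw [h4]
      nlinarith [vnorm_nonneg v]
    linarith

/-- Operator norm tail bound for a Gaussian matrix times a fixed matrix. -/
lemma measure_le_norm_mul_le (B : Matrix β κ ℝ) {b s : ℝ} (hb : 0 < b) (hB : ‖B‖ ≤ b)
    (hs : 0 < s) :
    stdGaussian α β {w | 2 * b * s ≤ ‖Matrix.of w * B‖} ≤
      ENNReal.ofReal (5 ^ Fintype.card κ * 2 ^ Fintype.card α * Real.exp (-(3 / 8 * s ^ 2))) := by
  obtain ⟨S, hcard, hS, hnet⟩ := exists_net (α := α) κ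
  have hsub : {w : α → β → ℝ | 2 * b * s ≤ ‖Matrix.of w * B‖} ⊆
      ⋃ y ∈ S, {w | s ^ 2 * (2 * b) ^ 2 ≤
        (Matrix.of w *ᵥ (B *ᵥ y)) ⬝ᵥ (Matrix.of w *ᵥ (B *ᵥ y))} := by
    intro w hw
    rw [Set.mem_ofPred_eq] at hw
    by_contra hno
    simp only [Set.mem_iUnion, Set.mem_ofPred_eq, not_exists, not_le] at hno
    have hlt : ∀ y ∈ S, vnorm ((Matrix.of w * B) *ᵥ y) < 2 * b * s := fun y hy => by
      refine lt_of_pow_lt_pow_left₀ 2 (by positivity) ?_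
      rw [vnorm_sq, ← mulVec_mulVec, mul_pow, mul_comm]
      exact hno y hy
    obtain ⟨c, hc, hcS⟩ : ∃ c < 2 * b * s, ∀ y ∈ S, vnorm ((Matrix.of w * B) *ᵥ y) ≤ c := by
      rcases S.eq_empty_or_nonempty with rfl | hne
      · exact ⟨0, by positivity, by simp⟩
      · obtain ⟨y, hy, hmax⟩ := S.exists_max_image (fun y => vnorm ((Matrix.of w * B) *ᵥ y)) hne
        exact ⟨_, hlt y hy, hmax⟩
    exact absurd (hw.trans (hnet _ _ hcS)) (not_le.2 hc)
  refine (measure_mono hsub).trans ((measure_biUnion_finset_le _ _).trans ?_)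
  have hy : ∀ y ∈ S, stdGaussian α β {w | s ^ 2 * (2 * b) ^ 2 ≤
        (Matrix.of w *ᵥ (B *ᵥ y)) ⬝ᵥ (Matrix.of w *ᵥ (B *ᵥ y))} ≤
      ENNReal.ofReal (2 ^ Fintype.card α * Real.exp (-(3 / 8 * s ^ 2))) := by
    intro y hy
    refine measure_sq_mulVec_ge_le _ (by positivity) ?_ _
    rw [← vnorm_sq]
    refine pow_le_pow_left₀ (vnorm_nonneg _) ((vnorm_mulVec_le B y).trans ?_) 2
    have := mul_le_mul hB (hS y hy) (vnorm_nonneg _) hb.le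
    linarith
  refine (Finset.sum_le_sum hy).trans ?_
  rw [Finset.sum_const, nsmul_eq_mul, mul_assoc,
    ENNReal.ofReal_mul (by positivity : (0 : ℝ) ≤ 5 ^ Fintype.card κ)]
  refine mul_le_mul_left ?_ _
  rw [ENNReal.ofReal_pow (by norm_num : (0 : ℝ) ≤ 5)]
  have h5 : (S.card : ENNReal) ≤ 5 ^ Fintype.card κ := by exact_mod_cast hcard
  simpa using h5

lemma pow_mul_exp_le {n d : ℕ} {γ : ℝ} (hn : 1 ≤ n) (hγ : 2 ≤ γ) :
    (5 : ℝ) ^ d * 2 ^ d *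
      Real.exp (-(3 / 8 * (3 / 2 * (2 * √(d : ℝ) + √(2 * γ * Real.log n))) ^ 2)) ≤
      (n : ℝ) ^ (-γ) := by
  have hn' : (1 : ℝ) ≤ n := by exact_mod_cast hn
  have hlog := Real.log_nonneg hn'
  have h1 : √(d : ℝ) ^ 2 = d := Real.sq_sqrt (by positivity)
  have h2 : √(2 * γ * Real.log n) ^ 2 = 2 * γ * Real.log n := Real.sq_sqrt (by positivity)
  have h3 : 0 ≤ √(d : ℝ) * √(2 * γ * Real.log n) := by positivity
  have h4 : Real.log 10 ≤ 3 := by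
    rw [Real.log_le_iff_le_exp (by norm_num)]
    have := Real.exp_one_gt_d9
    have e : Real.exp 3 = Real.exp 1 ^ 3 := by
      rw [← Real.exp_nat_mul]
      norm_num
    rw [e]
    calc (10 : ℝ) ≤ 2.7 ^ 3 := by norm_num
      _ ≤ _ := by gcongr; linarith
  have h5 : (5 : ℝ) ^ d * 2 ^ d = Real.exp (d * Real.log 10) := by
    rw [← mul_pow, Real.exp_nat_mul, Real.exp_log (by norm_num)]
    norm_num
  rw [h5, ← Real.exp_add, Real.rpow_def_of_pos (by linarith), Real.exp_le_exp]
  have h6 : 0 ≤ γ * Real.log n := by positivity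
  have h7 : (0 : ℝ) ≤ d := by positivity
  nlinarith

end Net

section LeaveOneOut

open scoped Matrix.Norms.L2Operator

variable {n d m : ℕ}

lemma norm_submatrix_le {α β γ : Type*} [Fintype α] [Fintype β] [Fintype γ] [DecidableEq α]
    [DecidableEq β] [DecidableEq γ] (X : Matrix α β ℝ) {f : γ → α} (hf : Function.Injective f) :
    ‖X.submatrix f id‖ ≤ ‖X‖ := by
  refine norm_le_of_dotProduct_le (norm_nonneg _) fun v => ?_
  refine le_trans ?_ (mulVec_dotProduct_self_le X v)
  have h : X.submatrix f id *ᵥ v = fun a => (X *ᵥ v) (f a) := rfl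
  rw [h]
  simp only [dotProduct]
  rw [← Finset.sum_image (f := fun a => (X *ᵥ v) a * (X *ᵥ v) a) (s := Finset.univ)
    fun a _ b _ hab => hf hab]
  exact Finset.sum_le_sum_of_subset_of_nonneg (Finset.subset_univ _)
    fun _ _ _ => mul_self_nonneg _

lemma measure_le_of_mask {γ b : ℝ} (hn : 1 ≤ n) (hd : 1 ≤ d) (hγ : 2 ≤ γ) (hb : 0 < b) (i : Fin n)
    {S : Set (Fin n × Fin d → Fin m → ℝ)} (hS : MeasurableSet S)
    (h : ∀ W₀ ∈ S, ∃ B : Matrix (Fin m) (Fin d) ℝ, ‖B‖ ≤ b ∧ ∀ W ∈ S,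
      mask (Matrix.of W) i = mask (Matrix.of W₀) i →
      3 * b * (2 * √(d : ℝ) + √(2 * γ * Real.log n)) ≤ ‖blk (Matrix.of W) i * B‖) :
    stdGaussian (Fin n × Fin d) (Fin m) S ≤ ENNReal.ofReal ((n : ℝ) ^ (-γ)) := by
  set τ := 2 * √(d : ℝ) + √(2 * γ * Real.log n) with hτ
  have hτ0 : 0 < τ := by
    have : 0 < √(d : ℝ) := Real.sqrt_pos.2 (by exact_mod_cast hd)
    positivity
  let p : Fin n × Fin d → Prop := fun q => q.1 = i
  let ν : Measure (Fin m → ℝ) := Measure.pi fun _ => ProbabilityTheory.gaussianReal 0 1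
  have hmp := measurePreserving_piEquivPiSubtypeProd (fun _ : Fin n × Fin d => ν) p
  set e := MeasurableEquiv.piEquivPiSubtypeProd (fun _ : Fin n × Fin d => Fin m → ℝ) p with he
  have h1 : stdGaussian (Fin n × Fin d) (Fin m) S =
      ((stdGaussian {q // p q} (Fin m)).prod (stdGaussian {q // ¬ p q} (Fin m)))
        (e.symm ⁻¹' S) := by
    have := (hmp.symm e).measure_preimage_equiv S
    exact this.symm
  rw [h1, Measure.prod_apply_symm (e.symm.measurable hS)]
  have hval : ∀ w₁ w₂ q, e.symm (w₁, w₂) q = if h : p q then w₁ ⟨q, h⟩ else w₂ ⟨q, h⟩ := by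
    intro w₁ w₂ q
    rfl
  have hslice : ∀ w₂, stdGaussian {q // p q} (Fin m) ((fun w₁ => (w₁, w₂)) ⁻¹' (e.symm ⁻¹' S)) ≤
      ENNReal.ofReal ((n : ℝ) ^ (-γ)) := by
    intro w₂
    rcases Set.eq_empty_or_nonempty ((fun w₁ => (w₁, w₂)) ⁻¹' (e.symm ⁻¹' S)) with h0 | ⟨w₀, h0⟩
    · rw [h0]
      simp
    obtain ⟨B, hB, hBS⟩ := h _ h0
    have hcard : Fintype.card {q // p q} = d := by
      have : {q // p q} ≃ Fin d :=
        { toFun := fun q => q.1.2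
          invFun := fun a => ⟨(i, a), rfl⟩
          left_inv := by
            rintro ⟨⟨j, a⟩, hj⟩
            exact Subtype.ext (Prod.ext (Eq.symm hj) rfl)
          right_inv := fun a => rfl }
      rw [Fintype.card_congr this, Fintype.card_fin]
    refine (measure_mono (t := {w | 2 * b * (3 / 2 * τ) ≤ ‖Matrix.of w * B‖}) fun w hw => ?_).trans
      ((measure_le_norm_mul_le B hb hB (by positivity)).trans ?_)
    · have h2 := hBS _ hw (by
        ext q k
        simp only [mask, Matrix.of_apply, hval]
        by_cases hq : q.1 = i
        · rw [if_pos hq, if_pos hq]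
        · rw [if_neg hq, if_neg hq, dif_neg hq, dif_neg hq])
      have h3 : blk (Matrix.of (e.symm (w, w₂))) i * B =
          (Matrix.of w * B).submatrix (fun a => (⟨(i, a), rfl⟩ : {q // p q})) id := by
        ext a k
        simp only [blk, mul_apply, submatrix_apply, Matrix.of_apply, hval, id]
        refine Finset.sum_congr rfl fun j _ => ?_
        rw [dif_pos rfl]
      rw [h3] at h2
      have h4 := h2.trans (norm_submatrix_le _ fun a a' haa => by simpa using haa)
      change 2 * b * (3 / 2 * τ) ≤ _
      linarith
    · rw [hcard, Fintype.card_fin]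
      exact ENNReal.ofReal_le_ofReal (pow_mul_exp_le hn hγ)
  refine (lintegral_mono hslice).trans ?_
  simp

lemma isClosed_setOf_exists_isSingularTriple (B : Matrix (Fin n × Fin d) (Fin m) ℝ)
    (T : Matrix (Fin m) (Fin m) ℝ) (σ r c t : ℝ) (i : Fin n) :
    IsClosed {W : Fin n × Fin d → Fin m → ℝ | ‖mask (Matrix.of W) i‖ ≤ c ∧
      ∃ (U : Matrix (Fin n × Fin d) (Fin d) ℝ) (V : Matrix (Fin m) (Fin d) ℝ) (s : Fin d → ℝ),
        IsSingularTriple r (B + σ • mask (Matrix.of W) i) U V s ∧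
          t ≤ ‖blk (Matrix.of W) i * (T * V)‖} := by
  let K : Set (Matrix (Fin n × Fin d) (Fin d) ℝ × Matrix (Fin m) (Fin d) ℝ) :=
    Metric.closedBall 0 1 ×ˢ Metric.closedBall 0 1
  have hK : IsCompact K := (isCompact_closedBall _ _).prod (isCompact_closedBall _ _)
  have : CompactSpace K := isCompact_iff_compactSpace.1 hK
  have hmask : Continuous fun W : Fin n × Fin d → Fin m → ℝ => mask (Matrix.of W) i := by
    refine continuous_matrix fun p b => ?_
    simp only [mask, Matrix.of_apply]
    split_ifs <;> fun_prop
  have hblk : Continuous fun W : Fin n × Fin d → Fin m → ℝ => blk (Matrix.of W) i :=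
    continuous_matrix fun a b => by
      simp only [blk, Matrix.of_apply]
      fun_prop
  have hD : Continuous fun x : (Fin n × Fin d → Fin m → ℝ) × K => B + σ • mask (Matrix.of x.1) i :=
    continuous_const.add ((hmask.comp continuous_fst).const_smul σ)
  have hU : Continuous fun x : (Fin n × Fin d → Fin m → ℝ) × K => x.2.1.1 := by fun_prop
  have hV : Continuous fun x : (Fin n × Fin d → Fin m → ℝ) × K => x.2.1.2 := by fun_prop
  let D : (Fin n × Fin d → Fin m → ℝ) × K → Matrix (Fin n × Fin d) (Fin m) ℝ :=
    fun x => B + σ • mask (Matrix.of x.1) i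
  let s : (Fin n × Fin d → Fin m → ℝ) × K → Fin d → ℝ := fun x => ((x.2.1.1)ᵀ * D x * x.2.1.2).diag
  have hs : Continuous s := ((hU.matrix_transpose.matrix_mul hD).matrix_mul hV).matrix_diag
  let F : Set ((Fin n × Fin d → Fin m → ℝ) × K) := {x | ‖mask (Matrix.of x.1) i‖ ≤ c ∧
    IsSingularTriple r (D x) x.2.1.1 x.2.1.2 (s x) ∧
    t ≤ ‖blk (Matrix.of x.1) i * (T * x.2.1.2)‖}
  have hF : IsClosed F := by
    refine (isClosed_le (hmask.comp continuous_fst).norm continuous_const).inter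
      (IsClosed.inter ?_ (isClosed_le continuous_const
        ((hblk.comp continuous_fst).matrix_mul (continuous_const.matrix_mul hV)).norm))
    have : {x | IsSingularTriple r (D x) x.2.1.1 x.2.1.2 (s x)} =
        {x : (Fin n × Fin d → Fin m → ℝ) × K | (x.2.1.1)ᵀ * x.2.1.1 = 1} ∩
        ({x : (Fin n × Fin d → Fin m → ℝ) × K | (x.2.1.2)ᵀ * x.2.1.2 = 1} ∩
        ({x : (Fin n × Fin d → Fin m → ℝ) × K | D x * x.2.1.2 = x.2.1.1 * diagonal (s x)} ∩
        ({x : (Fin n × Fin d → Fin m → ℝ) × K | (D x)ᵀ * x.2.1.1 = x.2.1.2 * diagonal (s x)} ∩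
        {x : (Fin n × Fin d → Fin m → ℝ) × K | ∀ a, r ≤ s x a}))) := by
      ext x
      exact ⟨fun h => ⟨h.1, h.2, h.3, h.4, h.5⟩, fun h => ⟨h.1, h.2.1, h.2.2.1, h.2.2.2.1,
        h.2.2.2.2⟩⟩
    change IsClosed {x | IsSingularTriple r (D x) x.2.1.1 x.2.1.2 (s x)}
    rw [this]
    refine (isClosed_eq (hU.matrix_transpose.matrix_mul hU) continuous_const).inter
      ((isClosed_eq (hV.matrix_transpose.matrix_mul hV) continuous_const).inter
      ((isClosed_eq (hD.matrix_mul hV) (hU.matrix_mul hs.matrix_diagonal)).inter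
      ((isClosed_eq (hD.matrix_transpose.matrix_mul hU) (hV.matrix_mul hs.matrix_diagonal)).inter
      ?_)))
    have : {x : (Fin n × Fin d → Fin m → ℝ) × K | ∀ a, r ≤ s x a} =
        ⋂ a, {x : (Fin n × Fin d → Fin m → ℝ) × K | r ≤ s x a} := by
      ext x
      simp
    rw [this]
    exact isClosed_iInter fun a => isClosed_le continuous_const (continuous_pi_iff.1 hs a)
  convert isClosedMap_fst_of_compactSpace _ hF using 1
  ext W
  constructor
  · rintro ⟨hc, U, V, s', h, ht⟩
    have hUV : (U, V) ∈ K := by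
      refine ⟨?_, ?_⟩
      · simpa using norm_le_one_of_orthonormal h.left_orthonormal
      · simpa using norm_le_one_of_orthonormal h.right_orthonormal
    refine ⟨(W, ⟨(U, V), hUV⟩), ⟨hc, ?_, ht⟩, rfl⟩
    have : s (W, ⟨(U, V), hUV⟩) = s' := by
      change (Uᵀ * (B + σ • mask (Matrix.of W) i) * V).diag = s'
      rw [Matrix.mul_assoc, h.mul_right, ← Matrix.mul_assoc, h.left_orthonormal, Matrix.one_mul,
        diag_diagonal]
    rw [this]
    exact h
  · rintro ⟨x, ⟨hc, h, ht⟩, rfl⟩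
    exact ⟨hc, _, _, _, h, ht⟩

lemma measure_exists_isSingularTriple_le {γ b r σ c : ℝ} (hn : 1 ≤ n) (hd : 1 ≤ d) (hγ : 2 ≤ γ)
    (hb : 0 < b) (i : Fin n) (B : Matrix (Fin n × Fin d) (Fin m) ℝ)
    (T : Matrix (Fin m) (Fin m) ℝ)
    (hT : ∀ N : Matrix (Fin n × Fin d) (Fin m) ℝ, ‖N‖ ≤ c → ∀ U V, ∀ s : Fin d → ℝ,
      IsSingularTriple r (B + σ • N) U V s → ‖T * V‖ ≤ b)
    (huniq : ∀ N : Matrix (Fin n × Fin d) (Fin m) ℝ, ‖N‖ ≤ c → ∀ U V U' V', ∀ s s' : Fin d → ℝ,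
      IsSingularTriple r (B + σ • N) U V s → IsSingularTriple r (B + σ • N) U' V' s' →
        coproj V' * V = 0) :
    stdGaussian (Fin n × Fin d) (Fin m) {W | ‖mask (Matrix.of W) i‖ ≤ c ∧
      ∃ (U : Matrix (Fin n × Fin d) (Fin d) ℝ) (V : Matrix (Fin m) (Fin d) ℝ) (s : Fin d → ℝ),
        IsSingularTriple r (B + σ • mask (Matrix.of W) i) U V s ∧
          3 * b * (2 * √(d : ℝ) + √(2 * γ * Real.log n)) ≤ ‖blk (Matrix.of W) i * (T * V)‖} ≤
      ENNReal.ofReal ((n : ℝ) ^ (-γ)) := by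
  refine measure_le_of_mask hn hd hγ hb i
    (isClosed_setOf_exists_isSingularTriple B T σ r c _ i).measurableSet ?_
  rintro W₀ ⟨hc₀, U₀, V₀, s₀, h₀, -⟩
  refine ⟨T * V₀, hT _ hc₀ _ _ _ h₀, ?_⟩
  rintro W ⟨hc, U, V, s, h, hle⟩ hW
  rw [hW] at h
  refine hle.trans ?_
  have h1 : V = V₀ * (V₀ᵀ * V) := by
    have := huniq _ hc₀ _ _ _ _ _ _ h h₀
    rw [coproj, Matrix.sub_mul, Matrix.one_mul, sub_eq_zero, Matrix.mul_assoc] at this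
    exact this
  have h2 : ‖V₀ᵀ * V‖ ≤ 1 := by
    refine (norm_mul_le_mul (a := 1) (b := 1) ?_ ?_).trans_eq (one_mul 1)
    · rw [norm_transpose]
      exact norm_le_one_of_orthonormal h₀.right_orthonormal
    · exact norm_le_one_of_orthonormal h.right_orthonormal
  calc ‖blk (Matrix.of W) i * (T * V)‖ = ‖blk (Matrix.of W) i * (T * V₀) * (V₀ᵀ * V)‖ := by
        conv_lhs => rw [h1]
        simp only [Matrix.mul_assoc]
    _ ≤ ‖blk (Matrix.of W) i * (T * V₀)‖ * 1 := norm_mul_le_mul le_rfl h2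
    _ = _ := mul_one _

lemma measure_le_norm_blk_mul_le {γ : ℝ} (hn : 1 ≤ n) (hd : 1 ≤ d) (hγ : 2 ≤ γ) (i : Fin n)
    {V : Matrix (Fin m) (Fin d) ℝ} (hV : Vᵀ * V = 1) :
    stdGaussian (Fin n × Fin d) (Fin m)
      {W | 3 * 1 * (2 * √(d : ℝ) + √(2 * γ * Real.log n)) ≤ ‖blk (Matrix.of W) i * V‖} ≤
      ENNReal.ofReal ((n : ℝ) ^ (-γ)) := by
  refine measure_le_of_mask hn hd hγ one_pos i ?_ fun W₀ _ =>
    ⟨V, norm_le_one_of_orthonormal hV, fun W hW _ => hW⟩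
  refine (isClosed_le continuous_const (Continuous.norm ?_)).measurableSet
  refine Continuous.matrix_mul (continuous_matrix fun a b => ?_) continuous_const
  simp only [blk, Matrix.of_apply]
  fun_prop

end LeaveOneOut

section Perturbation

set_option linter.unusedSectionVars false

open scoped Matrix.Norms.L2Operator

variable {α β κ : Type*} [Fintype α] [Fintype β] [Fintype κ] [DecidableEq α] [DecidableEq β]
  [DecidableEq κ]

lemma IsSingularTriple.norm_coproj_mul_le_of_add {r : ℝ} (hr : 0 < r) {M : Matrix α κ ℝ}
    {A : Matrix κ β ℝ} {E : Matrix α β ℝ} {U : Matrix α κ ℝ} {V V₀ : Matrix β κ ℝ} {s : κ → ℝ}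
    (h : IsSingularTriple r (M * A + E) U V s) (hV₀ : V₀ᵀ * V₀ = 1) (hA : coproj V₀ * Aᵀ = 0) :
    r * ‖coproj V₀ * V‖ ≤ ‖E‖ := by
  refine (norm_mul_le_norm_mul_diagonal hr h.le).trans ?_
  have : coproj V₀ * V * diagonal s = coproj V₀ * (Eᵀ * U) := by
    rw [Matrix.mul_assoc, ← h.mul_left, transpose_add, Matrix.transpose_mul, Matrix.add_mul,
      Matrix.mul_add, Matrix.mul_assoc, ← Matrix.mul_assoc _ Aᵀ, hA, Matrix.zero_mul, zero_add]
  rw [this]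
  calc _ ≤ 1 * (‖E‖ * 1) := norm_mul_le_mul (norm_coproj_le hV₀)
        (norm_mul_le_mul (norm_transpose E).le (norm_le_one_of_orthonormal h.left_orthonormal))
    _ = _ := by ring

/-- Perturbation of the singular subspaces when a single block of rows is changed. -/
lemma IsSingularTriple.norm_coproj_mul_le_of_block {ι : Type*} [Fintype ι] [DecidableEq ι]
    {g σ : ℝ} (hg : 0 < g) (hσ : 0 < σ) {D D' : Matrix α β ℝ}
    {U U' : Matrix α κ ℝ} {V V' : Matrix β κ ℝ} {s s' : κ → ℝ}
    (h : IsSingularTriple (15 / 16 * g) D U V s) (h' : IsSingularTriple (15 / 16 * g) D' U' V' s')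
    (he : ‖D' * coproj V'‖ ≤ g / 16) {P : Matrix α ι ℝ} (hP : Pᵀ * P = 1) {X : Matrix ι β ℝ}
    (hD : D - D' = σ • (P * X)) (hX : σ * ‖X‖ ≤ g / 16) :
    ‖coproj U' * U‖ ≤ 1 / 14 ∧
      223 * (g * ‖coproj U' * U‖) ≤ 32 * (σ * ‖X‖ * ‖Pᵀ * U‖) + 240 * (σ * ‖X * V'‖) ∧
      15 * (g * ‖coproj V' * V‖) ≤ g * ‖coproj U' * U‖ + 16 * (σ * ‖X‖ * ‖Pᵀ * U‖) := by
  obtain ⟨h1, h2⟩ := norm_coproj_mul_le (by positivity) h h' he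
  have hV : ‖V‖ ≤ 1 := norm_le_one_of_orthonormal h.right_orthonormal
  have hU : ‖U‖ ≤ 1 := norm_le_one_of_orthonormal h.left_orthonormal
  have hP1 : ‖P‖ ≤ 1 := norm_le_one_of_orthonormal hP
  have hPU : ‖Pᵀ * U‖ ≤ 1 :=
    (norm_mul_le_mul ((norm_transpose P).le.trans hP1) hU).trans_eq (one_mul 1)
  have hE : ‖(D - D') * V‖ ≤ σ * ‖X * V‖ := by
    rw [hD, Matrix.smul_mul, norm_smul, Real.norm_of_nonneg hσ.le, Matrix.mul_assoc]
    exact mul_le_mul_of_nonneg_left ((norm_mul_le_mul hP1 le_rfl).trans_eq (one_mul _)) hσ.le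
  have hEt : ‖(D - D')ᵀ * U‖ ≤ σ * (‖X‖ * ‖Pᵀ * U‖) := by
    rw [hD, transpose_smul, Matrix.smul_mul, norm_smul, Real.norm_of_nonneg hσ.le,
      Matrix.transpose_mul, Matrix.mul_assoc]
    exact mul_le_mul_of_nonneg_left (norm_mul_le_mul (norm_transpose X).le le_rfl) hσ.le
  have hXV : ‖X * V‖ ≤ ‖X * V'‖ + ‖X‖ * ‖coproj V' * V‖ := by
    have : X * V = X * V' * (V'ᵀ * V) + X * (coproj V' * V) := by
      rw [coproj, Matrix.sub_mul, Matrix.mul_sub, Matrix.one_mul]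
      simp [Matrix.mul_assoc]
    rw [this]
    refine (norm_add_le _ _).trans (add_le_add ?_ (norm_mul_le_mul le_rfl le_rfl))
    have hV' : ‖V'ᵀ‖ ≤ 1 :=
      (norm_transpose V').le.trans (norm_le_one_of_orthonormal h'.right_orthonormal)
    calc _ ≤ ‖X * V'‖ * (1 * 1) := norm_mul_le_mul le_rfl (norm_mul_le_mul hV' hV)
      _ = _ := by ring
  have hXV1 : σ * ‖X * V‖ ≤ g / 16 := by
    refine le_trans ?_ hX
    exact mul_le_mul_of_nonneg_left ((norm_mul_le_mul le_rfl hV).trans_eq (mul_one _)) hσ.le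
  have hXU : σ * (‖X‖ * ‖Pᵀ * U‖) ≤ g / 16 := by
    have := mul_le_mul hX hPU (norm_nonneg _) (by positivity)
    linarith
  have hsV := norm_nonneg (coproj V' * V)
  have hsU := norm_nonneg (coproj U' * U)
  have h3 : σ * ‖X * V‖ ≤ σ * ‖X * V'‖ + g / 16 * ‖coproj V' * V‖ := by
    have := mul_le_mul_of_nonneg_left hXV hσ.le
    have := mul_le_mul_of_nonneg_right hX hsV
    linarith
  refine ⟨?_, by linarith, by linarith⟩
  have : g * ‖coproj U' * U‖ ≤ g * (1 / 14) := by linarith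
  exact le_of_mul_le_mul_left this hg

lemma coproj_mul_transpose_eq_zero {d : ℕ} {r : ℝ} {A : Matrix (Fin d) β ℝ}
    {U : Matrix (Fin d) (Fin d) ℝ} {V : Matrix β (Fin d) ℝ} {s : Fin d → ℝ}
    (h : IsSingularTriple r A U V s) : coproj V * Aᵀ = 0 := by
  have h1 : Aᵀ = V * diagonal s * Uᵀ := by
    rw [← h.mul_left, Matrix.mul_assoc, mul_eq_one_comm.1 h.left_orthonormal, Matrix.mul_one]
  rw [h1, ← Matrix.mul_assoc, ← Matrix.mul_assoc, coproj_mul_self h.right_orthonormal,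
    Matrix.zero_mul, Matrix.zero_mul]

lemma coproj_eq_of_coproj_mul_eq_zero {d : ℕ} {V V' : Matrix β (Fin d) ℝ} (hV : Vᵀ * V = 1)
    (h : coproj V' * V = 0) : V = V' * (V'ᵀ * V) ∧ coproj V = coproj V' := by
  have h1 : V = V' * (V'ᵀ * V) := by
    rw [coproj, Matrix.sub_mul, Matrix.one_mul, sub_eq_zero, Matrix.mul_assoc] at h
    exact h
  have h2 : (V'ᵀ * V)ᵀ * (V'ᵀ * V) = 1 := by
    rw [transpose_mul, transpose_transpose, Matrix.mul_assoc, ← h1, hV]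
  have h3 := mul_eq_one_comm.1 h2
  refine ⟨h1, ?_⟩
  rw [coproj, coproj]
  congr 1
  calc V * Vᵀ = V' * (V'ᵀ * V) * (V' * (V'ᵀ * V))ᵀ := by rw [← h1]
    _ = V' * ((V'ᵀ * V) * (V'ᵀ * V)ᵀ) * V'ᵀ := by
        rw [transpose_mul]
        simp only [Matrix.mul_assoc]
    _ = V' * V'ᵀ := by rw [h3, Matrix.mul_one]

variable {n d m : ℕ}

lemma ZStack_transpose_mul_self : (ZStack n d)ᵀ * ZStack n d = (n : ℝ) • 1 := by
  ext a b
  simp only [ZStack, Matrix.mul_apply, Matrix.transpose_apply, Matrix.of_apply,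
    Fintype.sum_prod_type, Matrix.smul_apply, Matrix.one_apply]
  by_cases hab : a = b <;> simp [hab, eq_comm]

lemma ZStack_mulVec_dotProduct_self (c : Fin d → ℝ) :
    (ZStack n d *ᵥ c) ⬝ᵥ (ZStack n d *ᵥ c) = n * (c ⬝ᵥ c) := by
  rw [mulVec_dotProduct_mulVec, ZStack_transpose_mul_self, smul_mulVec, one_mulVec,
    dotProduct_smul, smul_eq_mul]

lemma vnorm_ZStack_mulVec (c : Fin d → ℝ) : vnorm (ZStack n d *ᵥ c) = √(n : ℝ) * vnorm c := by
  rw [← sq_eq_sq₀ (vnorm_nonneg _) (by have := vnorm_nonneg c; positivity), mul_pow, vnorm_sq,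
    vnorm_sq, ZStack_mulVec_dotProduct_self, Real.sq_sqrt (by positivity)]

lemma norm_ZStack_le : ‖ZStack n d‖ ≤ √(n : ℝ) :=
  norm_le_of_vnorm_mulVec_le (by positivity) fun c => (vnorm_ZStack_mulVec c).le

lemma ZStack_mulVec_ne_zero (hn : 1 ≤ n) (c : Fin d → ℝ) (hc : c ≠ 0) : ZStack n d *ᵥ c ≠ 0 := by
  intro h
  have h1 := ZStack_mulVec_dotProduct_self (n := n) c
  rw [h, zero_dotProduct] at h1
  have h2 := dotProduct_self_pos hc
  have h3 : (0 : ℝ) < n := by exact_mod_cast hn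
  have := mul_pos h3 h2
  linarith

lemma vnorm_add_le (v w : β → ℝ) : vnorm (v + w) ≤ vnorm v + vnorm w := by
  simp only [vnorm_eq_norm, WithLp.toLp_add]
  exact norm_add_le _ _

lemma sq_mul_le_transpose_mulVec_ZStack {A : Matrix (Fin d) (Fin m) ℝ} {g : ℝ} (hg0 : 0 ≤ g)
    (hg : g = √(n : ℝ) * sigmaMin A) {E : Matrix (Fin n × Fin d) (Fin m) ℝ} (hE : ‖E‖ ≤ g / 16)
    (c : Fin d → ℝ) :
    (15 / 16 * g) ^ 2 * ((ZStack n d *ᵥ c) ⬝ᵥ (ZStack n d *ᵥ c)) ≤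
      ((ZStack n d * A + E)ᵀ *ᵥ (ZStack n d *ᵥ c)) ⬝ᵥ
        ((ZStack n d * A + E)ᵀ *ᵥ (ZStack n d *ᵥ c)) := by
  set y := ZStack n d *ᵥ c with hy
  rw [← vnorm_sq, ← vnorm_sq, ← mul_pow]
  have hy0 := vnorm_nonneg y
  refine pow_le_pow_left₀ (by positivity) ?_ 2
  have h1 : (n : ℝ) • (Aᵀ *ᵥ c) = (ZStack n d * A + E)ᵀ *ᵥ y + (-1 : ℝ) • (Eᵀ *ᵥ y) := by
    rw [transpose_add, add_mulVec, transpose_mul, hy, ← mulVec_mulVec, mulVec_mulVec c,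
      ZStack_transpose_mul_self, smul_mulVec, one_mulVec, mulVec_smul]
    simp
  have h2 := vnorm_add_le ((ZStack n d * A + E)ᵀ *ᵥ y) ((-1 : ℝ) • (Eᵀ *ᵥ y))
  rw [← h1, vnorm_smul, vnorm_smul, abs_neg, abs_one, one_mul, Nat.abs_cast] at h2
  have h3 : vnorm (Eᵀ *ᵥ y) ≤ g / 16 * vnorm y := by
    refine (vnorm_mulVec_le _ _).trans (mul_le_mul_of_nonneg_right ?_ hy0)
    rwa [norm_transpose]
  have h4 : g * vnorm y ≤ n * vnorm (Aᵀ *ᵥ c) := by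
    rw [hy, vnorm_ZStack_mulVec, hg]
    have h5 := sigmaMin_mul_vnorm_le A c
    calc √(n : ℝ) * sigmaMin A * (√(n : ℝ) * vnorm c)
        = (√(n : ℝ) * √(n : ℝ)) * (sigmaMin A * vnorm c) := by ring
      _ = n * (sigmaMin A * vnorm c) := by rw [Real.mul_self_sqrt (by positivity)]
      _ ≤ _ := by gcongr
  linarith

/-- The embedding of the `i`-th block of coordinates. -/
def blockEmb (i : Fin n) : Matrix (Fin n × Fin d) (Fin d) ℝ :=
  Matrix.of fun p b => if p = (i, b) then 1 else 0

lemma blockEmb_transpose_mul {k : ℕ} (i : Fin n) (X : Matrix (Fin n × Fin d) (Fin k) ℝ) :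
    (blockEmb i : Matrix (Fin n × Fin d) (Fin d) ℝ)ᵀ * X = blk X i := by
  ext a b
  simp [blockEmb, Matrix.mul_apply, blk]

lemma blockEmb_transpose_mul_self (i : Fin n) :
    (blockEmb i : Matrix (Fin n × Fin d) (Fin d) ℝ)ᵀ *
      (blockEmb i : Matrix (Fin n × Fin d) (Fin d) ℝ) = 1 := by
  rw [blockEmb_transpose_mul]
  ext a b
  simp [blockEmb, blk, Matrix.one_apply]

lemma sub_mask (X : Matrix (Fin n × Fin d) (Fin m) ℝ) (i : Fin n) :
    X - mask X i = (blockEmb i : Matrix (Fin n × Fin d) (Fin d) ℝ) * blk X i := by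
  ext ⟨j, a⟩ b
  by_cases h : j = i <;> simp [mask, blockEmb, Matrix.mul_apply, blk, h]

lemma sigmaMin_le_norm (hd : 1 ≤ d) (A : Matrix (Fin d) (Fin m) ℝ) : sigmaMin A ≤ ‖A‖ := by
  let c : Fin d → ℝ := fun _ => 1
  have hc : c ≠ 0 := fun h => one_ne_zero (congrFun h ⟨0, hd⟩)
  have h1 := (sigmaMin_mul_vnorm_le A c).trans (vnorm_mulVec_le _ _)
  rw [norm_transpose] at h1
  exact le_of_mul_le_mul_right h1 (vnorm_pos hc)

end Perturbation

section PerturbationBounds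

open scoped Matrix.Norms.L2Operator

variable {n d m : ℕ} {g σ L τ μ : ℝ} {A : Matrix (Fin d) (Fin m) ℝ}
  {W : Matrix (Fin n × Fin d) (Fin m) ℝ}

lemma isSingularTriple_ZStack_of_isSVDTriple (hn : 1 ≤ n) (hg : 0 < g)
    (hA : g = √(n : ℝ) * sigmaMin A) {E : Matrix (Fin n × Fin d) (Fin m) ℝ} (hE : ‖E‖ ≤ g / 16)
    {U : Matrix (Fin n × Fin d) (Fin d) ℝ} {S : Matrix (Fin d) (Fin d) ℝ}
    {V : Matrix (Fin m) (Fin d) ℝ} (h : IsSVDTriple (ZStack n d * A + E) U S V) :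
    IsSingularTriple (15 / 16 * g) (ZStack n d * A + E) U V fun a => S a a :=
  h.isSingularTriple <| h.le_of_forall_le (ZStack_mulVec_ne_zero hn) <|
    sq_mul_le_transpose_mulVec_ZStack hg.le hA hE

lemma sq_sigmaMin_mul_le (hA : 0 < sigmaMin A) (c : Fin d → ℝ) :
    sigmaMin A ^ 2 *
        (((1 : Matrix (Fin d) (Fin d) ℝ) *ᵥ c) ⬝ᵥ ((1 : Matrix (Fin d) (Fin d) ℝ) *ᵥ c)) ≤
      (Aᵀ *ᵥ ((1 : Matrix (Fin d) (Fin d) ℝ) *ᵥ c)) ⬝ᵥ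
        (Aᵀ *ᵥ ((1 : Matrix (Fin d) (Fin d) ℝ) *ᵥ c)) := by
  rw [one_mulVec, ← vnorm_sq, ← vnorm_sq, ← mul_pow]
  exact pow_le_pow_left₀ (mul_nonneg hA.le (vnorm_nonneg c)) (sigmaMin_mul_vnorm_le A c) 2

lemma exists_orthonormal_coproj_mul_transpose_eq_zero (hA : 0 < sigmaMin A) :
    ∃ V : Matrix (Fin m) (Fin d) ℝ, Vᵀ * V = 1 ∧ coproj V * Aᵀ = 0 := by
  obtain ⟨U, V, s, h⟩ := exists_isSingularTriple (D := A) (M := (1 : Matrix (Fin d) (Fin d) ℝ))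
    (by simp) hA (sq_sigmaMin_mul_le hA)
  exact ⟨V, h.right_orthonormal, coproj_mul_transpose_eq_zero h⟩

lemma IsSVDTriple.eq_mul_of_coproj_mul_transpose_eq_zero (hA : 0 < sigmaMin A)
    {U₀ S₀ : Matrix (Fin d) (Fin d) ℝ} {V₀ V' : Matrix (Fin m) (Fin d) ℝ}
    (h : IsSVDTriple A U₀ S₀ V₀) (hV' : V'ᵀ * V' = 1) (hAV' : coproj V' * Aᵀ = 0) :
    V₀ = V' * (V'ᵀ * V₀) ∧ coproj V₀ = coproj V' := by
  have h1 : IsSingularTriple (sigmaMin A) A U₀ V₀ fun a => S₀ a a :=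
    h.isSingularTriple <| h.le_of_forall_le (M := 1) (by simp) (sq_sigmaMin_mul_le hA)
  have h2 : IsSingularTriple (sigmaMin A) ((1 : Matrix (Fin d) (Fin d) ℝ) * A + 0) U₀ V₀
      fun a => S₀ a a := by simpa using h1
  refine coproj_eq_of_coproj_mul_eq_zero h.1 ?_
  have h3 := h2.norm_coproj_mul_le_of_add hA hV' hAV'
  rw [norm_zero] at h3
  rw [← norm_le_zero_iff]
  by_contra! hlt
  linarith [mul_pos hA hlt]

/-- Bounds on the diagonal factor of a singular triple of `ZA + E`. -/
lemma IsSVDTriple.norm_inv_le_and_norm_le (hn : 1 ≤ n) (hd : 1 ≤ d) (hg : 0 < g)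
    (hA : g = √(n : ℝ) * sigmaMin A) {E : Matrix (Fin n × Fin d) (Fin m) ℝ} (hE : ‖E‖ ≤ g / 16)
    {U : Matrix (Fin n × Fin d) (Fin d) ℝ} {S : Matrix (Fin d) (Fin d) ℝ}
    {V : Matrix (Fin m) (Fin d) ℝ} (h : IsSVDTriple (ZStack n d * A + E) U S V) :
    ‖S⁻¹‖ ≤ 2 / g ∧ ‖S‖ ≤ 2 * √(n : ℝ) * ‖A‖ := by
  have h1 := isSingularTriple_ZStack_of_isSVDTriple hn hg hA hE h
  have hU := norm_le_one_of_orthonormal h1.left_orthonormal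
  have hV := norm_le_one_of_orthonormal h1.right_orthonormal
  constructor
  · rw [h.eq_diagonal]
    refine (norm_inv_diagonal_le (by positivity) h1.le).trans ?_
    rw [inv_eq_one_div, div_le_div_iff₀ (by positivity) hg]
    linarith
  · have h2 : S = Uᵀ * ((ZStack n d * A + E) * V) := by
      rw [h.2.2.2.1, ← Matrix.mul_assoc, h1.left_orthonormal, Matrix.one_mul]
    have h3 : ‖ZStack n d * A + E‖ ≤ √(n : ℝ) * ‖A‖ + g / 16 :=
      (norm_add_le _ _).trans (add_le_add (norm_mul_le_mul norm_ZStack_le le_rfl) hE)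
    have h4 : ‖S‖ ≤ 1 * ((√(n : ℝ) * ‖A‖ + g / 16) * 1) :=
      h2 ▸ norm_mul_le_mul ((norm_transpose U).le.trans hU) (norm_mul_le_mul h3 hV)
    have h5 : g ≤ √(n : ℝ) * ‖A‖ := by
      rw [hA]
      exact mul_le_mul_of_nonneg_left (sigmaMin_le_norm hd A) (Real.sqrt_nonneg _)
    have : 0 ≤ √(n : ℝ) * ‖A‖ := by positivity
    linarith

/-- Comparison of the singular triples of `ZA + σW` and of its leave-one-out version. -/
lemma IsSingularTriple.leaveOneOut_bounds (hg : 0 < g) (hσ : 0 < σ) {i : Fin n}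
    {U U' : Matrix (Fin n × Fin d) (Fin d) ℝ} {V V' V₀ : Matrix (Fin m) (Fin d) ℝ}
    {s s' : Fin d → ℝ} (h : IsSingularTriple (15 / 16 * g) (ZStack n d * A + σ • W) U V s)
    (h' : IsSingularTriple (15 / 16 * g) (ZStack n d * A + σ • mask W i) U' V' s')
    (hE : ‖σ • mask W i‖ ≤ g / 16) (hL : ‖blk W i‖ ≤ L) (hσL : σ * L ≤ g / 16)
    (hμ : ‖blk U i‖ ≤ μ) (hV₀ : V₀ᵀ * V₀ = 1) (hWV₀ : ‖blk W i * V₀‖ ≤ 3 * τ)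
    (hWV' : ‖blk W i * (coproj V₀ * V')‖ ≤ τ / 5) :
    ‖coproj U' * U‖ ≤ 1 / 14 ∧
      223 * (g * ‖coproj U' * U‖) ≤ 32 * (σ * L * μ) + 768 * (σ * τ) ∧
      15 * (g * ‖coproj V' * V‖) ≤ g * ‖coproj U' * U‖ + 16 * (σ * L * μ) := by
  have hX : σ * ‖blk W i‖ ≤ g / 16 := (mul_le_mul_of_nonneg_left hL hσ.le).trans hσL
  obtain ⟨h1, h2, h3⟩ := h.norm_coproj_mul_le_of_block hg hσ h'
    (h'.norm_mul_coproj_le (by positivity) (by linarith) rfl hE) (blockEmb_transpose_mul_self i)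
    (X := blk W i) (by rw [← sub_mask, smul_sub]; abel) hX
  rw [blockEmb_transpose_mul] at h2 h3
  have hL0 : 0 ≤ L := (norm_nonneg _).trans hL
  have h4 : σ * ‖blk W i‖ * ‖blk U i‖ ≤ σ * L * μ :=
    mul_le_mul (mul_le_mul_of_nonneg_left hL hσ.le) hμ (norm_nonneg _) (by positivity)
  have h5 : ‖blk W i * V'‖ ≤ 16 / 5 * τ := by
    have h6 : blk W i * V' = blk W i * V₀ * (V₀ᵀ * V') + blk W i * (coproj V₀ * V') := by
      rw [coproj, Matrix.sub_mul, Matrix.mul_sub, Matrix.one_mul]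
      simp [Matrix.mul_assoc]
    have h7 : ‖V₀ᵀ‖ ≤ 1 := (norm_transpose V₀).le.trans (norm_le_one_of_orthonormal hV₀)
    have h8 : ‖blk W i * V₀ * (V₀ᵀ * V')‖ ≤ 3 * τ * (1 * 1) :=
      norm_mul_le_mul hWV₀
        (norm_mul_le_mul h7 (norm_le_one_of_orthonormal h'.right_orthonormal))
    rw [h6]
    linarith [norm_add_le (blk W i * V₀ * (V₀ᵀ * V')) (blk W i * (coproj V₀ * V'))]
  have h9 : σ * ‖blk W i * V'‖ ≤ 16 / 5 * (σ * τ) := by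
    linarith [mul_le_mul_of_nonneg_left h5 hσ.le]
  exact ⟨h1, by linarith, by linarith⟩

lemma IsSingularTriple.norm_blk_mul_sub_le (hg : 0 < g) (hσ : 0 < σ) (hτ : 0 ≤ τ) {i : Fin n}
    {U U' : Matrix (Fin n × Fin d) (Fin d) ℝ} {V V' V₀ : Matrix (Fin m) (Fin d) ℝ}
    {s s' : Fin d → ℝ} (h : IsSingularTriple (15 / 16 * g) (ZStack n d * A + σ • W) U V s)
    (h' : IsSingularTriple (15 / 16 * g) (ZStack n d * A + σ • mask W i) U' V' s')
    (hE : ‖σ • mask W i‖ ≤ g / 16) (hL : ‖blk W i‖ ≤ L) (hσL : σ * L ≤ g / 16)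
    (hμ : ‖blk U i‖ ≤ μ) (hV₀ : V₀ᵀ * V₀ = 1) (hWV₀ : ‖blk W i * V₀‖ ≤ 3 * τ)
    (hWV' : ‖blk W i * (coproj V₀ * V')‖ ≤ τ / 5) (hV₀V : ‖coproj V₀ * V‖ ≤ 1 / 15)
    {R : Matrix (Fin d) (Fin d) ℝ} (hR : IsPolar (V₀ᵀ * V) R) :
    ‖blk W i * (V - V₀ * R)‖ ≤ 3 / 4 * L * μ + 5 / 2 * τ := by
  obtain ⟨-, h1, h2⟩ := h.leaveOneOut_bounds hg hσ h' hE hL hσL hμ hV₀ hWV₀ hWV'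
  have hL0 : 0 ≤ L := (norm_nonneg _).trans hL
  have hμ0 : 0 ≤ μ := (norm_nonneg _).trans hμ
  have hdec : blk W i * (V - V₀ * R) = blk W i * V₀ * (V₀ᵀ * V - R) +
      blk W i * (coproj V₀ * V') * (V'ᵀ * V) + blk W i * (coproj V₀ * (coproj V' * V)) := by
    simp only [coproj, Matrix.sub_mul, Matrix.mul_sub, Matrix.one_mul, Matrix.mul_assoc]
    abel
  have h3 : ‖blk W i * V₀ * (V₀ᵀ * V - R)‖ ≤ 3 * τ * (1 / 15) ^ 2 :=
    norm_mul_le_mul hWV₀ <| ((hR.norm_sub_mul_le h.right_orthonormal hV₀).1).trans <|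
      pow_le_pow_left₀ (norm_nonneg _) hV₀V 2
  have h4 : ‖blk W i * (coproj V₀ * V') * (V'ᵀ * V)‖ ≤ τ / 5 * (1 * 1) :=
    norm_mul_le_mul hWV' <| norm_mul_le_mul
      ((norm_transpose V').le.trans (norm_le_one_of_orthonormal h'.right_orthonormal))
      (norm_le_one_of_orthonormal h.right_orthonormal)
  have h5 : ‖blk W i * (coproj V₀ * (coproj V' * V))‖ ≤ L * (1 * ‖coproj V' * V‖) :=
    norm_mul_le_mul hL (norm_mul_le_mul (norm_coproj_le hV₀) le_rfl)
  have h6 : g * (L * ‖coproj V' * V‖) ≤ g * (3 / 4 * (L * μ) + 2 * τ) := by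
    have h7 : L * (15 * (g * ‖coproj V' * V‖)) ≤ σ * L * (17 * (L * μ) + 4 * τ) := by
      have h8 : 15 * (g * ‖coproj V' * V‖) ≤ σ * (17 * (L * μ) + 4 * τ) := by
        have : 0 ≤ σ * L * μ := by positivity
        have : 0 ≤ σ * τ := by positivity
        linarith
      linarith [mul_le_mul_of_nonneg_left h8 hL0]
    have h9 := mul_le_mul_of_nonneg_right hσL (show 0 ≤ 17 * (L * μ) + 4 * τ by positivity)
    have : 0 ≤ g * (L * μ) := by positivity
    have : 0 ≤ g * τ := by positivity
    linarith
  have h7 := le_of_mul_le_mul_left h6 hg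
  rw [hdec]
  refine (norm_add₃_le).trans ?_
  linarith

lemma IsSingularTriple.norm_sub_mul_le (hg : 0 < g) (hσ : 0 < σ) (hτ : 0 ≤ τ) {i : Fin n}
    {U U' : Matrix (Fin n × Fin d) (Fin d) ℝ} {V V' V₀ : Matrix (Fin m) (Fin d) ℝ}
    {s s' : Fin d → ℝ} (h : IsSingularTriple (15 / 16 * g) (ZStack n d * A + σ • W) U V s)
    (h' : IsSingularTriple (15 / 16 * g) (ZStack n d * A + σ • mask W i) U' V' s')
    (hE : ‖σ • mask W i‖ ≤ g / 16) (hL : ‖blk W i‖ ≤ L) (hσL : σ * L ≤ g / 16)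
    (hμ : ‖blk U i‖ ≤ μ) (hV₀ : V₀ᵀ * V₀ = 1) (hWV₀ : ‖blk W i * V₀‖ ≤ 3 * τ)
    (hWV' : ‖blk W i * (coproj V₀ * V')‖ ≤ τ / 5)
    {Q : Matrix (Fin d) (Fin d) ℝ} (hQ : IsPolar (U'ᵀ * U) Q) :
    ‖U - U' * Q‖ ≤ 12 * σ * L / g * μ + 4 * σ * τ / g := by
  obtain ⟨h1, h2, -⟩ := h.leaveOneOut_bounds hg hσ h' hE hL hσL hμ hV₀ hWV₀ hWV'
  have h3 := (hQ.norm_sub_mul_le h.left_orthonormal h'.left_orthonormal).2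
  have hL0 : 0 ≤ L := (norm_nonneg _).trans hL
  have hμ0 : 0 ≤ μ := (norm_nonneg _).trans hμ
  have h4 := mul_le_mul_of_nonneg_right h1 (norm_nonneg (coproj U' * U))
  have h5 : ‖U - U' * Q‖ * g ≤ 15 / 14 * (g * ‖coproj U' * U‖) := by
    have : ‖U - U' * Q‖ ≤ 15 / 14 * ‖coproj U' * U‖ := by linarith
    linarith [mul_le_mul_of_nonneg_right this hg.le]
  have h6 : 12 * σ * L / g * μ + 4 * σ * τ / g = (12 * (σ * L * μ) + 4 * (σ * τ)) / g := by
    field_simp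
  rw [h6, le_div_iff₀ hg]
  have : 0 ≤ σ * L * μ := by positivity
  have : 0 ≤ σ * τ := by positivity
  linarith

/-- The union bound behind the leave-one-out estimates. -/
lemma measure_compl_leaveOneOut_le {c γ : ℝ} (hn : 1 ≤ n) (hd : 1 ≤ d) (hγ : 2 ≤ γ) (hg : 0 < g)
    (hσ : 0 < σ) (hσc : σ * c ≤ g / 16) {V' : Matrix (Fin m) (Fin d) ℝ} (hV' : V'ᵀ * V' = 1)
    (hAV' : coproj V' * Aᵀ = 0) :
    stdGaussian (Fin n × Fin d) (Fin m) {W | ∀ i,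
      (‖mask (of W) i‖ ≤ c → ∀ (U : Matrix (Fin n × Fin d) (Fin d) ℝ)
        (V : Matrix (Fin m) (Fin d) ℝ) (s : Fin d → ℝ),
        IsSingularTriple (15 / 16 * g) (ZStack n d * A + σ • mask (of W) i) U V s →
          ‖blk (of W) i * (coproj V' * V)‖ ≤ (2 * √(d : ℝ) + √(2 * γ * Real.log n)) / 5) ∧
      ‖blk (of W) i * V'‖ ≤ 3 * (2 * √(d : ℝ) + √(2 * γ * Real.log n))}ᶜ ≤
      ENNReal.ofReal (2 * (n : ℝ) ^ (-γ + 1)) := by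
  have hn0 : (0 : ℝ) < n := by exact_mod_cast hn
  have hsm : ∀ N : Matrix (Fin n × Fin d) (Fin m) ℝ, ‖N‖ ≤ c → ‖σ • N‖ ≤ g / 16 := by
    intro N hN
    rw [norm_smul, Real.norm_of_nonneg hσ.le]
    exact (mul_le_mul_of_nonneg_left hN hσ.le).trans hσc
  have hbad (i : Fin n) := measure_exists_isSingularTriple_le (r := 15 / 16 * g) (σ := σ) (c := c)
    (b := 1 / 15) hn hd hγ (by norm_num) i (ZStack n d * A) (coproj V')
    (fun N hN U V s h => by
      have h1 := (h.norm_coproj_mul_le_of_add (by positivity) hV' hAV').trans (hsm N hN)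
      refine le_of_mul_le_mul_left (a := 15 / 16 * g) ?_ (by positivity)
      linarith)
    (fun N hN U V U' V' s s' h h' => h.coproj_mul_eq_zero (by positivity) h'
      (h'.norm_mul_coproj_le (by positivity) (by linarith) rfl (hsm N hN)) (by linarith))
  have hbad' (i : Fin n) := measure_le_norm_blk_mul_le hn hd hγ i hV'
  refine (measure_mono ?_).trans <| (measure_iUnion_fintype_le _ _).trans <|
    (Finset.sum_le_sum fun i _ => (measure_union_le _ _).trans
      (add_le_add (hbad i) (hbad' i))).trans_eq ?_
  · intro W hW
    by_contra hW'
    apply hW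
    simp only [Set.mem_iUnion, Set.mem_union, Set.mem_ofPred_eq, not_exists, not_or, not_and,
      not_le] at hW' ⊢
    intro i
    refine ⟨fun hc U V s h => ?_, ?_⟩
    · linarith [(hW' i).1 hc U V s h]
    · linarith [(hW' i).2]
  · rw [Finset.sum_const, Finset.card_univ, Fintype.card_fin, nsmul_eq_mul,
      ← ENNReal.ofReal_add (by positivity) (by positivity), ← ENNReal.ofReal_natCast,
      ← ENNReal.ofReal_mul (by positivity), Real.rpow_add hn0, Real.rpow_one]
    congr 1
    ring

end PerturbationBounds

lemma le_measure_of_measure_compl_le {Ω : Type*} [MeasurableSpace Ω] {μ : Measure Ω}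
    [IsProbabilityMeasure μ] {s : Set Ω} {x : ℝ} (hx : 0 ≤ x) (hs : μ sᶜ ≤ ENNReal.ofReal x) :
    ENNReal.ofReal (1 - x) ≤ μ s := by
  rw [ENNReal.ofReal_sub _ hx, ENNReal.ofReal_one, tsub_le_iff_right]
  calc 1 = μ (s ∪ sᶜ) := by rw [Set.union_compl_self, measure_univ]
    _ ≤ μ s + μ sᶜ := measure_union_le _ _
    _ ≤ _ := add_le_add_right hs _

/-- Lemma 5.11: perturbation bounds for the top-d singular triples of
D = ZA + σW, the leave-one-out matrices D^(i) = ZA + σW^(i), and A. -/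
theorem singular_pert_bounds :
    ∃ C : ℝ, 0 < C ∧
      ∀ (n d m : ℕ), 1 ≤ n → 1 ≤ d → d ≤ m →
      ∀ A : Matrix (Fin d) (Fin m) ℝ, 0 < sigmaMin A →
      ∀ σ γ : ℝ, 0 < σ → 2 ≤ γ →
      σ ≤ Real.sqrt (n : ℝ) * sigmaMin A / (16 * bnd1 n d m γ) →
      ENNReal.ofReal (1 - C * (n : ℝ) ^ (-γ + 1)) ≤
        stdGaussian (Fin n × Fin d) (Fin m) {W |
          (∀ i, opNorm (blk (Matrix.of W) i) ≤
            Real.sqrt (d : ℝ) + Real.sqrt (m : ℝ) + Real.sqrt (2 * γ * Real.log n)) →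
          opNorm (Matrix.of W) ≤ bnd2 n d m γ →
          (∀ i, opNorm (mask (Matrix.of W) i) ≤ bnd2 n d m γ) →
          ∀ (U : Matrix (Fin n × Fin d) (Fin d) ℝ) (Sg : Matrix (Fin d) (Fin d) ℝ)
            (V : Matrix (Fin m) (Fin d) ℝ),
            IsSVDTriple (ZStack n d * A + σ • Matrix.of W) U Sg V →
          ∀ (U0 Sg0 : Matrix (Fin d) (Fin d) ℝ) (V0 : Matrix (Fin m) (Fin d) ℝ),
            IsSVDTriple A U0 Sg0 V0 →
            (opNorm Sg⁻¹ ≤ 2 / (Real.sqrt (n : ℝ) * sigmaMin A) ∧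
              opNorm Sg ≤ 2 * Real.sqrt (n : ℝ) * opNorm A) ∧
            (∀ R : Matrix (Fin d) (Fin d) ℝ, IsPolar (V0ᵀ * V) R →
              opNorm (V - V0 * R) ≤
                4 * σ * bnd2 n d m γ / (Real.sqrt (n : ℝ) * sigmaMin A) ∧
              ∀ i, opNorm (blk (Matrix.of W) i * (V - V0 * R)) ≤
                3 / 4 * (Real.sqrt (m : ℝ) + Real.sqrt (d : ℝ) +
                    Real.sqrt (2 * γ * Real.log n)) * (⨆ j : Fin n, opNorm (blk U j)) +
                  5 / 2 * (2 * Real.sqrt (d : ℝ) + Real.sqrt (2 * γ * Real.log n))) ∧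
            (∀ (i : Fin n) (Ui : Matrix (Fin n × Fin d) (Fin d) ℝ)
              (Sgi : Matrix (Fin d) (Fin d) ℝ) (Vi : Matrix (Fin m) (Fin d) ℝ),
              IsSVDTriple (ZStack n d * A + σ • mask (Matrix.of W) i) Ui Sgi Vi →
              ∀ QU : Matrix (Fin d) (Fin d) ℝ, IsPolar (Uiᵀ * U) QU →
                opNorm (U - Ui * QU) ≤
                  12 * σ * (Real.sqrt (m : ℝ) + Real.sqrt (d : ℝ) +
                      Real.sqrt (2 * γ * Real.log n)) /
                    (Real.sqrt (n : ℝ) * sigmaMin A) * (⨆ j : Fin n, opNorm (blk U j)) +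
                  4 * σ * (2 * Real.sqrt (d : ℝ) + Real.sqrt (2 * γ * Real.log n)) /
                    (Real.sqrt (n : ℝ) * sigmaMin A))} := by
  open scoped Matrix.Norms.L2Operator in
  refine ⟨2, by norm_num, fun n d m hn hd hdm A hA σ γ hσ hγ hσle => ?_⟩
  simp only [opNorm_eq_norm]
  set g := √(n : ℝ) * sigmaMin A with hgdef
  set t := √(2 * γ * Real.log n) with htdef
  have hn1 : (1 : ℝ) ≤ n := by exact_mod_cast hn
  have hd1 : (1 : ℝ) ≤ d := by exact_mod_cast hd
  have hg : 0 < g := mul_pos (Real.sqrt_pos.2 (by linarith)) hA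
  have ht : 0 ≤ t := Real.sqrt_nonneg _
  have hsm : 0 ≤ √(m : ℝ) := Real.sqrt_nonneg _
  have hsd : 0 ≤ √(d : ℝ) := Real.sqrt_nonneg _
  have hτ : 0 ≤ 2 * √(d : ℝ) + t := by positivity
  have hb2 : bnd2 n d m γ ≤ bnd1 n d m γ := by
    have h1 : 0 ≤ γ * Real.log n := mul_nonneg (by linarith) (Real.log_nonneg hn1)
    refine add_le_add le_rfl (Real.sqrt_le_sqrt ?_)
    linarith [le_mul_of_one_le_left h1 hn1]
  have hL2 : √(m : ℝ) + √(d : ℝ) + t ≤ bnd2 n d m γ := by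
    have h1 : √(d : ℝ) ≤ √((n : ℝ) * d) :=
      Real.sqrt_le_sqrt (le_mul_of_one_le_left (by linarith) hn1)
    rw [bnd2, ← htdef]
    linarith
  have hb1 : 0 < bnd1 n d m γ := by
    have : 0 < √(d : ℝ) := Real.sqrt_pos.2 (by linarith)
    linarith
  have hσc : σ * bnd2 n d m γ ≤ g / 16 := by
    rw [le_div_iff₀ (by positivity)] at hσle
    linarith [mul_le_mul_of_nonneg_left hb2 hσ.le]
  have hσL : σ * (√(m : ℝ) + √(d : ℝ) + t) ≤ g / 16 :=
    (mul_le_mul_of_nonneg_left hL2 hσ.le).trans hσc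
  have hsmul {N : Matrix (Fin n × Fin d) (Fin m) ℝ} (hN : ‖N‖ ≤ bnd2 n d m γ) :
      ‖σ • N‖ ≤ σ * bnd2 n d m γ := by
    rw [norm_smul, Real.norm_of_nonneg hσ.le]
    exact mul_le_mul_of_nonneg_left hN hσ.le
  obtain ⟨V', hV', hAV'⟩ := exists_orthonormal_coproj_mul_transpose_eq_zero hA
  have hcompl := measure_compl_leaveOneOut_le hn hd hγ hg hσ hσc hV' hAV'
  refine (le_measure_of_measure_compl_le (by positivity) hcompl).trans (measure_mono ?_)
  intro W hW hWi hWn hWm U Sg V hUV U0 Sg0 V0 hUV0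
  obtain ⟨hV0eq, hV0co⟩ := hUV0.eq_mul_of_coproj_mul_transpose_eq_zero hA hV' hAV'
  have hV0 : V0ᵀ * V0 = 1 := hUV0.1
  have hE := (hsmul hWn).trans hσc
  have hEi (i : Fin n) := (hsmul (hWm i)).trans hσc
  have h := isSingularTriple_ZStack_of_isSVDTriple hn hg hgdef hE hUV
  have hL (i : Fin n) : ‖blk (of W) i‖ ≤ √(m : ℝ) + √(d : ℝ) + t := by
    linarith [hWi i]
  have hμ (i : Fin n) : ‖blk U i‖ ≤ ⨆ j, ‖blk U j‖ :=
    le_ciSup (f := fun j => ‖blk U j‖) (Set.finite_range _).bddAbove i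
  have hWV0 (i : Fin n) : ‖blk (of W) i * V0‖ ≤ 3 * (2 * √(d : ℝ) + t) := by
    rw [hV0eq, ← Matrix.mul_assoc]
    refine (norm_mul_le_mul (hW i).2 (norm_mul_le_mul ((norm_transpose V').le.trans
      (norm_le_one_of_orthonormal hV')) (norm_le_one_of_orthonormal hV0))).trans_eq ?_
    ring
  have hs0 : 15 / 16 * g * ‖coproj V0 * V‖ ≤ σ * bnd2 n d m γ := by
    rw [hV0co]
    exact (h.norm_coproj_mul_le_of_add (by positivity) hV' hAV').trans (hsmul hWn)
  have hs0' : ‖coproj V0 * V‖ ≤ 1 / 15 := by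
    refine le_of_mul_le_mul_left (a := 15 / 16 * g) ?_ (by positivity)
    linarith
  refine ⟨hUV.norm_inv_le_and_norm_le hn hd hg hgdef hE, fun R hR => ⟨?_, fun i => ?_⟩,
    fun i Ui Sgi Vi hUVi QU hQU => ?_⟩
  · rw [le_div_iff₀ hg]
    have h1 := (hR.norm_sub_mul_le h.right_orthonormal hV0).2
    have h2 := mul_le_mul_of_nonneg_right hs0' (norm_nonneg (coproj V0 * V))
    have h3 : ‖V - V0 * R‖ ≤ 16 / 15 * ‖coproj V0 * V‖ := by linarith
    have h4 := mul_le_mul_of_nonneg_right h3 hg.le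
    have h5 : 0 ≤ g * ‖coproj V0 * V‖ := by positivity
    linarith
  · obtain ⟨Ui, Vi, s, h'⟩ := exists_isSingularTriple (ZStack_mulVec_ne_zero hn)
      (show 0 < 15 / 16 * g by positivity)
      (sq_mul_le_transpose_mulVec_ZStack hg.le hgdef (hEi i))
    exact h.norm_blk_mul_sub_le hg hσ hτ h' (hEi i) (hL i) hσL (hμ i) hV0 (hWV0 i)
      (hV0co ▸ (hW i).1 (hWm i) Ui Vi s h') hs0' hR
  · have h' := isSingularTriple_ZStack_of_isSVDTriple hn hg hgdef (hEi i) hUVi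
    exact h.norm_sub_mul_le hg hσ hτ h' (hEi i) (hL i) hσL (hμ i) hV0 (hWV0 i)
      (hV0co ▸ (hW i).1 (hWm i) Ui Vi _ h') hQU

end GOPP
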